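/- There is no convex 4-polytope P such that for every facet F of P the interval [∅, F] of the face lattice L(P) is order-isomorphic to the face lattice of the rhombic triacontahedron, and for every vertex v of P the interval [v, P] of L(P) is order-isomorphic to the face lattice of the icosidodecahedron. -/

import Mathlib

/-! Generic definitions about flags, flag orbits, and abstract polytopes. -/

variable {α : Type*} [PartialOrder α]

/-- Two flags (maximal chains) are in the same orbit of the automorphism group
(the group of order automorphisms) if some order automorphism maps one onto the other. -/
def SameFlagOrbit (Φ Ψ : Flag α) : Prop :=
  ∃ γ : α ≃o α, γ '' (Φ : Set α) = (Ψ : Set α)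

/-- The automorphism group has exactly two orbits on the flags. -/
def TwoFlagOrbits (α : Type*) [PartialOrder α] : Prop :=
  ∃ Φ Ψ : Flag α, ¬ SameFlagOrbit Φ Ψ ∧
    ∀ Ω : Flag α, SameFlagOrbit Ω Φ ∨ SameFlagOrbit Ω Ψ

/-- `Ψ` is the flag `Φ^i`: it differs from `Φ` in exactly the rank-`i` element
(with respect to the rank function `rk`). -/
def IsIAdjacent (rk : α → ℤ) (i : ℤ) (Φ Ψ : Flag α) : Prop :=
  Φ ≠ Ψ ∧ ∀ x : α, rk x ≠ i → (x ∈ Φ ↔ x ∈ Ψ)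

/-- A two-orbit polytope (with rank function `rk`, adjacency indices `0, …, n-1`)
is in class `2_I` if, for every flag `Φ` and every `i < n`, the `i`-adjacent flag `Φ^i`
lies in the same orbit as `Φ` exactly when `i ∈ I`. -/
def InClass (rk : α → ℤ) (n : ℕ) (I : Set ℕ) : Prop :=
  TwoFlagOrbits α ∧
    ∀ (Φ Ψ : Flag α) (i : ℕ), i < n → IsIAdjacent rk i Φ Ψ →
      (SameFlagOrbit Φ Ψ ↔ i ∈ I)

/-- An abstract polytope of rank `d`: a bounded poset, graded by a rank function `rk`
taking values `-1, 0, …, d`, in which every flag (maximal chain) has exactly one element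
of each rank, satisfying the diamond condition and strong flag-connectivity. -/
structure IsAbstractPolytope (α : Type*) [PartialOrder α] [BoundedOrder α]
    (rk : α → ℤ) (d : ℕ) : Prop where
  rk_bot : rk ⊥ = -1
  rk_top : rk ⊤ = d
  rk_strictMono : StrictMono rk
  rk_cover : ∀ x y : α, x ⋖ y → rk y = rk x + 1
  flag_ranks : ∀ (Φ : Flag α) (i : ℤ), -1 ≤ i → i ≤ d → ∃! x, x ∈ Φ ∧ rk x = i
  diamond : ∀ x y : α, x < y → rk y = rk x + 2 →
    ∃ a b : α, a ≠ b ∧ ∀ z : α, (x < z ∧ z < y) ↔ (z = a ∨ z = b)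
  connected : ∀ Φ Ψ : Flag α, ∃ (n : ℕ) (c : Fin (n + 1) → Flag α),
    c 0 = Φ ∧ c (Fin.last n) = Ψ ∧
    (∀ k : Fin n, ∃ i : ℤ, IsIAdjacent rk i (c k.castSucc) (c k.succ)) ∧
    (∀ k, (Φ : Set α) ∩ (Ψ : Set α) ⊆ (c k : Set α))
/-! Definitions about convex polytopes and their face lattices. -/

/-- Euclidean `d`-space. -/
abbrev EucSp (d : ℕ) : Type := EuclideanSpace ℝ (Fin d)

/-- A convex `d`-polytope: the convex hull of a finite set of points of `ℝ^d`,
with nonempty interior. -/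
def IsConvexPolytope {d : ℕ} (P : Set (EucSp d)) : Prop :=
  (∃ S : Finset (EucSp d), P = convexHull ℝ (S : Set (EucSp d))) ∧ (interior P).Nonempty

/-- The face lattice of `P`: the exposed faces of `P` (intersections of `P` with supporting
hyperplanes, together with `∅` and `P` itself), ordered by inclusion. -/
def Faces {d : ℕ} (P : Set (EucSp d)) : Type := {F : Set (EucSp d) // IsExposed ℝ P F}

noncomputable instance {d : ℕ} (P : Set (EucSp d)) : PartialOrder (Faces P) :=
  Subtype.partialOrder _

open scoped Classical

/-- The rank of a face: `-1` for the empty face, and otherwise its affine dimension. -/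
noncomputable def faceRank {d : ℕ} {P : Set (EucSp d)} (F : Faces P) : ℤ :=
  if F.1 = ∅ then -1
  else (Module.finrank ℝ (affineSpan ℝ F.1).direction : ℤ)
/-! The four two-orbit polyhedra. -/

open scoped RealInnerProductSpace

/-- The point `(a, b, c)` of Euclidean 3-space. -/
noncomputable def pt3 (a b c : ℝ) : EucSp 3 := (WithLp.equiv 2 (Fin 3 → ℝ)).symm ![a, b, c]

/-- The golden ratio. -/
noncomputable def goldenφ : ℝ := (1 + Real.sqrt 5) / 2

/-- The 12 vertices of the cuboctahedron: all permutations of the coordinates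
of `(±1, ±1, 0)`. -/
def cuboctaVerts : Set (EucSp 3) :=
  {x | ∃ ε δ : ℝ, (ε = 1 ∨ ε = -1) ∧ (δ = 1 ∨ δ = -1) ∧
    (x = pt3 ε δ 0 ∨ x = pt3 ε 0 δ ∨ x = pt3 0 ε δ)}

/-- The cuboctahedron. -/
noncomputable def Cuboctahedron : Set (EucSp 3) := convexHull ℝ cuboctaVerts

/-- The 30 vertices of the icosidodecahedron: all cyclic permutations of the coordinates
of `(0, 0, ±φ)` and of `(±1/2, ±φ/2, ±φ²/2)`. -/
def icosidodecaVerts : Set (EucSp 3) :=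
  {x | (∃ ε : ℝ, (ε = 1 ∨ ε = -1) ∧
        (x = pt3 0 0 (ε * goldenφ) ∨ x = pt3 (ε * goldenφ) 0 0 ∨ x = pt3 0 (ε * goldenφ) 0)) ∨
      (∃ ε₁ ε₂ ε₃ : ℝ, (ε₁ = 1 ∨ ε₁ = -1) ∧ (ε₂ = 1 ∨ ε₂ = -1) ∧ (ε₃ = 1 ∨ ε₃ = -1) ∧
        (x = pt3 (ε₁ / 2) (ε₂ * goldenφ / 2) (ε₃ * goldenφ ^ 2 / 2) ∨
         x = pt3 (ε₃ * goldenφ ^ 2 / 2) (ε₁ / 2) (ε₂ * goldenφ / 2) ∨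
         x = pt3 (ε₂ * goldenφ / 2) (ε₃ * goldenφ ^ 2 / 2) (ε₁ / 2)))}

/-- The icosidodecahedron. -/
noncomputable def Icosidodecahedron : Set (EucSp 3) := convexHull ℝ icosidodecaVerts

/-- The 14 vertices of the rhombic dodecahedron: the points `(±1, ±1, ±1)` together with
`(±2, 0, 0)`, `(0, ±2, 0)`, `(0, 0, ±2)`. -/
def rhombicDodecaVerts : Set (EucSp 3) :=
  {x | (∃ ε₁ ε₂ ε₃ : ℝ, (ε₁ = 1 ∨ ε₁ = -1) ∧ (ε₂ = 1 ∨ ε₂ = -1) ∧ (ε₃ = 1 ∨ ε₃ = -1) ∧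
        x = pt3 ε₁ ε₂ ε₃) ∨
      (∃ ε : ℝ, (ε = 2 ∨ ε = -2) ∧ (x = pt3 ε 0 0 ∨ x = pt3 0 ε 0 ∨ x = pt3 0 0 ε))}

/-- The rhombic dodecahedron. -/
noncomputable def RhombicDodecahedron : Set (EucSp 3) := convexHull ℝ rhombicDodecaVerts

/-- The rhombic triacontahedron: the polar dual of the icosidodecahedron. -/
noncomputable def RhombicTriacontahedron : Set (EucSp 3) :=
  {y | ∀ x ∈ Icosidodecahedron, ⟪x, y⟫ ≤ 1}

/-! ## Order-theoretic notions -/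

/-- An element of height one. -/
def Atm {β : Type*} [PartialOrder β] (x : β) : Prop := ¬ IsMin x ∧ ∀ y, y < x → IsMin y

/-- An element of coheight one. -/
def Coatm {β : Type*} [PartialOrder β] (x : β) : Prop := ¬ IsMax x ∧ ∀ y, x < y → IsMax y

/-- An element above exactly two atoms. -/
def Edg {β : Type*} [PartialOrder β] (x : β) : Prop :=
  ∃ a b : β, a ≠ b ∧ ∀ c, (Atm c ∧ c ≤ x) ↔ (c = a ∨ c = b)

lemma isMin_iso {β γ : Type*} [PartialOrder β] [PartialOrder γ] (f : β ≃o γ) (x : β) :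
    IsMin (f x) ↔ IsMin x := by
  constructor
  · intro h y hy
    exact f.le_iff_le.1 (h (f.le_iff_le.2 hy))
  · intro h y hy
    have := h (b := f.symm y) (by rw [f.symm_apply_le]; exact hy)
    rwa [f.le_symm_apply] at this

lemma isMax_iso {β γ : Type*} [PartialOrder β] [PartialOrder γ] (f : β ≃o γ) (x : β) :
    IsMax (f x) ↔ IsMax x := by
  constructor
  · intro h y hy
    exact f.le_iff_le.1 (h (f.le_iff_le.2 hy))
  · intro h y hy
    have := h (b := f.symm y) (by rw [f.le_symm_apply]; exact hy)
    rwa [f.symm_apply_le] at this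

lemma atm_iso {β γ : Type*} [PartialOrder β] [PartialOrder γ] (f : β ≃o γ) (x : β) :
    Atm (f x) ↔ Atm x := by
  unfold Atm
  rw [isMin_iso, f.surjective.forall]
  simp [isMin_iso]

lemma coatm_iso {β γ : Type*} [PartialOrder β] [PartialOrder γ] (f : β ≃o γ) (x : β) :
    Coatm (f x) ↔ Coatm x := by
  unfold Coatm
  rw [isMax_iso, f.surjective.forall]
  simp [isMax_iso]

lemma edg_iso {β γ : Type*} [PartialOrder β] [PartialOrder γ] (f : β ≃o γ) (x : β) :
    Edg (f x) ↔ Edg x := by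
  unfold Edg
  rw [f.surjective.exists]
  refine exists_congr fun a => ?_
  rw [f.surjective.exists]
  refine exists_congr fun b => ?_
  rw [f.surjective.forall]
  simp [atm_iso]

lemma isMin_below {β : Type*} [PartialOrder β] {F : β} (x : {G : β // G ≤ F}) :
    IsMin x ↔ IsMin x.1 := by
  constructor
  · intro h y hy
    exact h (b := ⟨y, hy.trans x.2⟩) hy
  · intro h y hy
    exact h (b := y.1) hy

lemma atm_below {β : Type*} [PartialOrder β] {F : β} (x : {G : β // G ≤ F}) :
    Atm x ↔ Atm x.1 := by
  unfold Atm
  rw [isMin_below]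
  refine and_congr Iff.rfl ⟨fun h y hy => ?_, fun h y hy => ?_⟩
  · exact (isMin_below _).1 (h ⟨y, hy.le.trans x.2⟩ hy)
  · exact (isMin_below _).2 (h y.1 hy)

lemma edg_below {β : Type*} [PartialOrder β] {F : β} (x : {G : β // G ≤ F}) :
    Edg x ↔ Edg x.1 := by
  constructor
  · rintro ⟨a, b, hab, h⟩
    refine ⟨a.1, b.1, fun h => hab (Subtype.ext h), fun c => ⟨?_, ?_⟩⟩
    · rintro ⟨h1, h2⟩
      rcases (h ⟨c, h2.trans x.2⟩).1 ⟨(atm_below _).2 h1, h2⟩ with h | h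
      · left; exact congrArg Subtype.val h
      · right; exact congrArg Subtype.val h
    · rintro (rfl | rfl)
      · have := (h a).2 (Or.inl rfl)
        exact ⟨(atm_below _).1 this.1, this.2⟩
      · have := (h b).2 (Or.inr rfl)
        exact ⟨(atm_below _).1 this.1, this.2⟩
  · rintro ⟨a, b, hab, h⟩
    have ha := (h a).2 (Or.inl rfl)
    have hb := (h b).2 (Or.inr rfl)
    refine ⟨⟨a, ha.2.trans x.2⟩, ⟨b, hb.2.trans x.2⟩, fun h => hab (congrArg Subtype.val h), ?_⟩
    intro c
    rw [atm_below, Subtype.ext_iff, Subtype.ext_iff]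
    exact h c.1

lemma coatm_above {β : Type*} [PartialOrder β] {v : β} (x : {G : β // v ≤ G}) (h : Coatm x) :
    Coatm x.1 := by
  refine ⟨fun hm => h.1 fun y hy => hm (b := y.1) hy, fun y hy z hz => ?_⟩
  have h1 : v ≤ y := x.2.trans hy.le
  have h2 : IsMax (⟨y, h1⟩ : {G : β // v ≤ G}) := h.2 ⟨y, h1⟩ hy
  exact h2 (b := ⟨z, h1.trans hz⟩) hz

/-! ## Faces of the convex hull of a finite set -/

lemma inner_le_hull {d : ℕ} {S : Set (EucSp d)} {L : EucSp d} {M : ℝ}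
    (h : ∀ s ∈ S, ⟪L, s⟫ ≤ M) : ∀ x ∈ convexHull ℝ S, ⟪L, x⟫ ≤ M := by
  have hc : Convex ℝ {x : EucSp d | ⟪L, x⟫ ≤ M} := by
    have := convex_halfSpace_le (𝕜 := ℝ) (f := fun x : EucSp d => ⟪L, x⟫)
      ⟨fun x y => inner_add_right _ _ _, fun c x => by simp [inner_smul_right]⟩ M
    exact this
  exact fun x hx => convexHull_min (show S ⊆ {x : EucSp d | ⟪L, x⟫ ≤ M} from h) hc hx

lemma face_hull_aux {d : ℕ} {S : Set (EucSp d)} {L : EucSp d} {M : ℝ}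
    (h : ∀ s ∈ S, ⟪L, s⟫ ≤ M) :
    {x ∈ convexHull ℝ S | ⟪L, x⟫ = M} = convexHull ℝ {s ∈ S | ⟪L, s⟫ = M} := by
  apply Set.Subset.antisymm
  · rintro x ⟨hx, hM⟩
    rw [convexHull_eq] at hx
    obtain ⟨ι, t, w, z, hw0, hw1, hz, rfl⟩ := hx
    have key : ∀ i ∈ t, w i * (M - ⟪L, z i⟫) = 0 := by
      have h0 : ∑ i ∈ t, w i * (M - ⟪L, z i⟫) = 0 := by
        rw [Finset.centerMass_eq_of_sum_1 _ _ hw1, inner_sum] at hM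
        simp only [inner_smul_right] at hM
        simp only [mul_sub, Finset.sum_sub_distrib, ← Finset.sum_mul, hw1, hM]
        ring
      exact (Finset.sum_eq_zero_iff_of_nonneg
        (fun i hi => mul_nonneg (hw0 i hi) (sub_nonneg.2 (h _ (hz i hi))))).1 h0
    rw [← Finset.centerMass_filter_ne_zero]
    refine Finset.centerMass_mem_convexHull _ (fun i hi => hw0 i (Finset.mem_filter.1 hi).1) ?_ ?_
    · rw [Finset.sum_filter_ne_zero, hw1]; norm_num
    · intro i hi
      obtain ⟨hi, hne⟩ := Finset.mem_filter.1 hi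
      refine ⟨hz i hi, ?_⟩
      rcases mul_eq_zero.1 (key i hi) with h | h
      · exact absurd h hne
      · linarith
  · intro x hx
    refine ⟨convexHull_mono (fun s hs => hs.1) hx, le_antisymm ?_ ?_⟩
    · exact inner_le_hull (fun s hs => hs.2.le) x hx
    · have := inner_le_hull (L := -L) (M := -M) (fun s hs => by
        rw [inner_neg_left, hs.2]) x hx
      rw [inner_neg_left] at this
      linarith

lemma face_form {d : ℕ} {Q : Set (EucSp d)} (G : Faces Q) (hG : G.1.Nonempty) :
    ∃ (L : EucSp d) (M : ℝ), (∀ x ∈ Q, ⟪L, x⟫ ≤ M) ∧ G.1 = {x ∈ Q | ⟪L, x⟫ = M} := by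
  obtain ⟨l, hl⟩ := G.2 hG
  obtain ⟨x0, hx0⟩ := hG
  have hl' : ∀ x, l x = ⟪(InnerProductSpace.toDual ℝ (EucSp d)).symm l, x⟫ := fun x => by
    rw [InnerProductSpace.toDual_symm_apply]
  refine ⟨(InnerProductSpace.toDual ℝ (EucSp d)).symm l, l x0, ?_, ?_⟩
  · intro x hx
    rw [← hl']
    rw [hl] at hx0
    exact hx0.2 x hx
  · rw [hl] at hx0 ⊢
    ext x
    simp only [Set.mem_ofPred_eq, ← hl']
    refine and_congr_right fun hx => ⟨fun h => le_antisymm (hx0.2 x hx) (h _ hx0.1), fun h y hy => ?_⟩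
    rw [h]; exact hx0.2 y hy

lemma isExposed_of_le {d : ℕ} {Q : Set (EucSp d)} {L : EucSp d} {M : ℝ}
    (h : ∀ x ∈ Q, ⟪L, x⟫ ≤ M) : IsExposed ℝ Q {x ∈ Q | ⟪L, x⟫ = M} := by
  rintro ⟨x0, hx0, hM⟩
  refine ⟨innerSL ℝ L, ?_⟩
  ext x
  simp only [Set.mem_ofPred_eq, innerSL_apply_apply]
  refine and_congr_right fun hx => ⟨fun h' y hy => ?_, fun h' => le_antisymm (h x hx) ?_⟩
  · rw [h']; exact h y hy
  · rw [← hM]; exact h' _ hx0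

/-- The face cut out by a supporting hyperplane. -/
def mkFace {d : ℕ} {Q : Set (EucSp d)} (L : EucSp d) (M : ℝ)
    (h : ∀ x ∈ Q, ⟪L, x⟫ ≤ M) : Faces Q := ⟨_, isExposed_of_le h⟩

lemma mem_mkFace {d : ℕ} {Q : Set (EucSp d)} {L : EucSp d} {M : ℝ}
    {h : ∀ x ∈ Q, ⟪L, x⟫ ≤ M} {x : EucSp d} : x ∈ (mkFace L M h).1 ↔ x ∈ Q ∧ ⟪L, x⟫ = M := Iff.rfl

lemma faces_le_def {d : ℕ} {Q : Set (EucSp d)} {G H : Faces Q} : G ≤ H ↔ G.1 ⊆ H.1 := Iff.rfl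

lemma isMin_face {d : ℕ} {Q : Set (EucSp d)} (G : Faces Q) : IsMin G ↔ G.1 = ∅ := by
  constructor
  · intro h
    have h1 : (⟨∅, isExposed_empty⟩ : Faces Q) ≤ G := faces_le_def.2 (Set.empty_subset _)
    exact Set.subset_empty_iff.1 (h h1)
  · intro h y hy
    rw [faces_le_def, h]; exact Set.empty_subset _

lemma isMax_face {d : ℕ} {Q : Set (EucSp d)} (G : Faces Q) : IsMax G ↔ G.1 = Q := by
  constructor
  · intro h
    have h1 : G ≤ (⟨Q, IsExposed.refl _⟩ : Faces Q) := faces_le_def.2 G.2.subset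
    exact Set.Subset.antisymm G.2.subset (h h1)
  · intro h y hy
    rw [faces_le_def, h]; exact y.2.subset

/-- `S` is a set of points spanning `Q`, each being an exposed point of `Q`. -/
structure Vert {d : ℕ} (S : Set (EucSp d)) (Q : Set (EucSp d)) : Prop where
  hull : Q = convexHull ℝ S
  exp : ∀ s ∈ S, IsExposed ℝ Q {s}

namespace Vert

variable {d : ℕ} {S Q : Set (EucSp d)}

lemma sub (h : Vert S Q) {s : EucSp d} (hs : s ∈ S) : s ∈ Q := by
  rw [h.hull]; exact subset_convexHull _ _ hs

lemma le_of (h : Vert S Q) {L : EucSp d} {M : ℝ} (hL : ∀ s ∈ S, ⟪L, s⟫ ≤ M) :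
    ∀ x ∈ Q, ⟪L, x⟫ ≤ M := by rw [h.hull]; exact inner_le_hull hL

lemma face_eq (h : Vert S Q) (G : Faces Q) : G.1 = convexHull ℝ (S ∩ G.1) := by
  rcases Set.eq_empty_or_nonempty G.1 with h0 | h0
  · rw [h0]; simp
  · obtain ⟨L, M, h1, h2⟩ := face_form G h0
    have h3 : S ∩ G.1 = {s ∈ S | ⟪L, s⟫ = M} := by
      rw [h2]; ext s
      exact ⟨fun hs => ⟨hs.1, hs.2.2⟩, fun hs => ⟨hs.1, h.sub hs.1, hs.2⟩⟩
    rw [h3, ← face_hull_aux (fun s hs => h1 s (h.sub hs)), ← h.hull, h2]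

lemma le_iff (h : Vert S Q) {G H : Faces Q} : G ≤ H ↔ ∀ s ∈ S, s ∈ G.1 → s ∈ H.1 := by
  constructor
  · intro hle s _ hs; exact hle hs
  · intro hle
    rw [faces_le_def, h.face_eq G, h.face_eq H]
    exact convexHull_mono fun s hs => ⟨hs.1, hle s hs.1 hs.2⟩

lemma eq_iff (h : Vert S Q) {G H : Faces Q} : G = H ↔ ∀ s ∈ S, s ∈ G.1 ↔ s ∈ H.1 := by
  constructor
  · rintro rfl; simp
  · intro hh
    exact le_antisymm (h.le_iff.2 fun s hs => (hh s hs).1) (h.le_iff.2 fun s hs => (hh s hs).2)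

lemma exists_mem (h : Vert S Q) {G : Faces Q} (hG : G.1.Nonempty) : ∃ s ∈ S, s ∈ G.1 := by
  by_contra hcon
  push Not at hcon
  have : S ∩ G.1 = ∅ := by
    ext s; simp only [Set.mem_inter_iff, Set.mem_empty_iff_false, iff_false]
    exact fun hs => hcon s hs.1 hs.2
  have h2 := h.face_eq G
  rw [this, convexHull_empty] at h2
  rw [h2] at hG
  exact Set.not_nonempty_empty hG

/-- the face `{s}` -/
def pt (h : Vert S Q) {s : EucSp d} (hs : s ∈ S) : Faces Q := ⟨{s}, h.exp s hs⟩

lemma pt_le (h : Vert S Q) {s : EucSp d} (hs : s ∈ S) (G : Faces Q) : h.pt hs ≤ G ↔ s ∈ G.1 := by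
  rw [faces_le_def]; exact Set.singleton_subset_iff

lemma atm_pt (h : Vert S Q) {s : EucSp d} (hs : s ∈ S) : Atm (h.pt hs) := by
  refine ⟨fun hm => ?_, fun y hy => ?_⟩
  · exact Set.singleton_ne_empty s ((isMin_face _).1 hm)
  · rw [isMin_face]
    rcases Set.subset_singleton_iff_eq.1 (show y.1 ⊆ {s} from hy.le) with h1 | h1
    · exact h1
    · exact absurd (show y = h.pt hs from Subtype.ext h1) hy.ne

lemma atm_iff (h : Vert S Q) (G : Faces Q) : Atm G ↔ ∃ s, ∃ hs : s ∈ S, G = h.pt hs := by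
  constructor
  · rintro ⟨h1, h2⟩
    rw [isMin_face, ← ne_eq, ← Set.nonempty_iff_ne_empty] at h1
    obtain ⟨s, hs, hsG⟩ := h.exists_mem h1
    refine ⟨s, hs, ?_⟩
    by_contra hne
    have := h2 _ (lt_of_le_of_ne ((h.pt_le hs G).2 hsG) (Ne.symm hne))
    exact (h.atm_pt hs).1 this
  · rintro ⟨s, hs, rfl⟩; exact h.atm_pt hs

lemma edg_iff (h : Vert S Q) (G : Faces Q) :
    Edg G ↔ ∃ s t, s ∈ S ∧ t ∈ S ∧ s ≠ t ∧ ∀ u ∈ S, u ∈ G.1 ↔ (u = s ∨ u = t) := by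
  have hinj : ∀ {s t} (hs : s ∈ S) (ht : t ∈ S), h.pt hs = h.pt ht ↔ s = t := by
    intro s t hs ht
    refine ⟨fun hh => Set.singleton_injective (congrArg Subtype.val hh), fun hh => ?_⟩
    subst hh; rfl
  constructor
  · rintro ⟨a, b, hab, hh⟩
    have ha := (hh a).2 (Or.inl rfl)
    have hb := (hh b).2 (Or.inr rfl)
    obtain ⟨s, hs, rfl⟩ := (h.atm_iff a).1 ha.1
    obtain ⟨t, ht, rfl⟩ := (h.atm_iff b).1 hb.1
    refine ⟨s, t, hs, ht, fun e => hab ((hinj hs ht).2 e), fun u hu => ?_⟩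
    have := hh (h.pt hu)
    rw [hinj hu hs, hinj hu ht, h.pt_le hu] at this
    rw [← this]
    exact ⟨fun h' => ⟨h.atm_pt hu, h'⟩, fun h' => h'.2⟩
  · rintro ⟨s, t, hs, ht, hne, hh⟩
    refine ⟨h.pt hs, h.pt ht, fun e => hne ((hinj hs ht).1 e), fun c => ⟨?_, ?_⟩⟩
    · rintro ⟨h1, h2⟩
      obtain ⟨u, hu, rfl⟩ := (h.atm_iff c).1 h1
      rw [hinj hu hs, hinj hu ht, ← hh u hu, ← h.pt_le hu]
      exact h2
    · rintro (rfl | rfl)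
      · exact ⟨h.atm_pt hs, (h.pt_le hs _).2 ((hh s hs).2 (Or.inl rfl))⟩
      · exact ⟨h.atm_pt ht, (h.pt_le ht _).2 ((hh t ht).2 (Or.inr rfl))⟩

/-- An edge is an atom of the interval above one of its vertices. -/
lemma atm_above (h : Vert S Q) {G : Faces Q} {s t : EucSp d} (hs : s ∈ S) (ht : t ∈ S)
    (hne : s ≠ t) (hG : ∀ u ∈ S, u ∈ G.1 ↔ (u = s ∨ u = t)) (hle : h.pt hs ≤ G) :
    Atm (⟨G, hle⟩ : {H : Faces Q // h.pt hs ≤ H}) := by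
  have htG : t ∈ G.1 := (hG t ht).2 (Or.inr rfl)
  refine ⟨fun hm => ?_, fun y hy z hz => ?_⟩
  · have h1 : (⟨h.pt hs, le_rfl⟩ : {H : Faces Q // h.pt hs ≤ H}) ≤ ⟨G, hle⟩ := hle
    have h2 : G ≤ h.pt hs := hm h1
    exact hne (h2 htG : t = s).symm
  · have hyt : t ∉ y.1.1 := by
      intro hty
      refine hy.not_ge (h.le_iff.2 fun u hu huG => ?_)
      rcases (hG u hu).1 huG with rfl | rfl
      · exact (h.pt_le hs _).1 y.2
      · exact hty
    refine h.le_iff.2 fun u hu huy => ?_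
    rcases (hG u hu).1 (hy.le huy) with rfl | rfl
    · exact (h.pt_le hs _).1 z.2
    · exact absurd huy hyt

lemma finite (h : Vert S Q) (hS : S.Finite) : Finite (Faces Q) := by
  have : Finite (Set S) := by
    have := hS.to_subtype
    infer_instance
  refine Finite.of_injective (fun G : Faces Q => {s : S | s.1 ∈ G.1}) fun G H hGH => ?_
  rw [h.eq_iff]
  intro s hs
  have := congrArg (fun A : Set S => (⟨s, hs⟩ : S) ∈ A) hGH
  simpa using this

end Vert

/-- A point of `S` that strictly maximizes a functional is exposed. -/
lemma exposed_of_strict {d : ℕ} {S Q : Set (EucSp d)} (hQ : Q = convexHull ℝ S) {s L : EucSp d}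
    (hs : s ∈ S) (h : ∀ t ∈ S, t ≠ s → ⟪L, t⟫ < ⟪L, s⟫) : IsExposed ℝ Q {s} := by
  have hle : ∀ t ∈ S, ⟪L, t⟫ ≤ ⟪L, s⟫ := by
    intro t ht
    by_cases hts : t = s
    · rw [hts]
    · exact (h t ht hts).le
  have h1 := isExposed_of_le (inner_le_hull hle)
  rw [face_hull_aux hle] at h1
  have h2 : {t ∈ S | ⟪L, t⟫ = ⟪L, s⟫} = {s} := by
    ext t
    simp only [Set.mem_ofPred_eq, Set.mem_singleton_iff]
    constructor
    · rintro ⟨ht, he⟩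
      by_contra hts
      exact (h t ht hts).ne he
    · rintro rfl; exact ⟨hs, rfl⟩
  rw [h2, convexHull_singleton, ← hQ] at h1
  exact h1

lemma exists_vert {d : ℕ} {Q : Set (EucSp d)} (T : Finset (EucSp d))
    (hT : Q = convexHull ℝ (T : Set (EucSp d))) :
    ∃ S : Set (EucSp d), S.Finite ∧ Vert S Q := by
  classical
  have hex : ∃ n, ∃ S : Finset (EucSp d), Q = convexHull ℝ (S : Set (EucSp d)) ∧ S.card = n :=
    ⟨_, T, hT, rfl⟩
  obtain ⟨S, hS, hn⟩ := Nat.find_spec hex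
  refine ⟨S, S.finite_toSet, hS, fun s hs => ?_⟩
  have hs' : s ∈ S := hs
  have hnot : s ∉ convexHull ℝ ((S.erase s : Finset (EucSp d)) : Set (EucSp d)) := by
    intro hmem
    refine Nat.find_min hex (m := (S.erase s).card) ?_ ⟨S.erase s, ?_, rfl⟩
    · rw [← hn]; exact Finset.card_erase_lt_of_mem hs'
    · rw [hS]
      apply Set.Subset.antisymm
      · refine convexHull_min (fun t ht => ?_) (convex_convexHull _ _)
        by_cases hts : t = s
        · rw [hts]; exact hmem
        · exact subset_convexHull _ _ (by simpa [hts] using ht)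
      · exact convexHull_mono (by simp)
  obtain ⟨f, u, h1, h2⟩ := geometric_hahn_banach_closed_point (convex_convexHull ℝ _)
    ((S.erase s).finite_toSet.isClosed_convexHull ℝ) hnot
  refine exposed_of_strict (L := (InnerProductSpace.toDual ℝ (EucSp d)).symm f) hS hs ?_
  intro t ht hts
  rw [InnerProductSpace.toDual_symm_apply, InnerProductSpace.toDual_symm_apply]
  exact (h1 t (subset_convexHull _ _ (by
    simpa [hts] using ht))).trans h2

/-! ## Linear algebra in four-space -/

lemma sign_aux {c0 c1 c2 a b a' b' a'' b'' : ℝ} (ha : 0 < a) (hb : 0 < b) (ha' : 0 < a')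
    (hb' : 0 < b') (ha'' : 0 < a'') (hb'' : 0 < b'') (h0 : c1 * a + c2 * b = 0)
    (h1 : c0 * a' + c2 * b' = 0) (h2 : c0 * a'' + c1 * b'' = 0) : c0 = 0 ∧ c1 = 0 ∧ c2 = 0 := by
  have key : c0 = 0 := by
    rcases lt_trichotomy c0 0 with h | h | h
    · have hc2 : 0 < c2 := by
        by_contra hn
        nlinarith [mul_pos_of_neg_of_neg h (neg_lt_zero.2 ha'), mul_nonneg (neg_nonneg.2 (not_lt.1 hn)) hb'.le]
      have hc1 : 0 < c1 := by
        by_contra hn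
        nlinarith [mul_pos_of_neg_of_neg h (neg_lt_zero.2 ha''), mul_nonneg (neg_nonneg.2 (not_lt.1 hn)) hb''.le]
      nlinarith [mul_pos hc1 ha, mul_pos hc2 hb]
    · exact h
    · have hc2 : c2 < 0 := by
        by_contra hn
        nlinarith [mul_pos h ha', mul_nonneg (not_lt.1 hn) hb'.le]
      have hc1 : c1 < 0 := by
        by_contra hn
        nlinarith [mul_pos h ha'', mul_nonneg (not_lt.1 hn) hb''.le]
      nlinarith [mul_pos (neg_pos.2 hc1) ha, mul_pos (neg_pos.2 hc2) hb]
  subst key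
  refine ⟨rfl, ?_, ?_⟩
  · have : c1 * b'' = 0 := by linarith
    exact (mul_eq_zero.1 this).resolve_right hb''.ne'
  · have : c2 * b' = 0 := by linarith
    exact (mul_eq_zero.1 this).resolve_right hb'.ne'

lemma finrank_orth_of_linInd {k : ℕ} (f : Fin k → EucSp 4) (hf : LinearIndependent ℝ f) :
    Module.finrank ℝ ((Submodule.span ℝ (Set.range f))ᗮ : Submodule ℝ (EucSp 4)) + k = 4 := by
  have h1 := Submodule.finrank_add_finrank_orthogonal (Submodule.span ℝ (Set.range f))
  rw [finrank_span_eq_card hf, finrank_euclideanSpace] at h1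
  simp at h1
  omega

lemma three_vectors (x0 x1 x2 y0 y1 y2 p q : EucSp 4) (hpq : LinearIndependent ℝ ![p, q])
    (hp0 : ⟪p, x0⟫ = 0) (hp1 : ⟪p, x1⟫ = 0) (hp2 : ⟪p, x2⟫ = 0)
    (hq0 : ⟪q, x0⟫ = 0) (hq1 : ⟪q, x1⟫ = 0) (hq2 : ⟪q, x2⟫ = 0)
    (h00 : ⟪x0, y0⟫ = 0) (h11 : ⟪x1, y1⟫ = 0) (h22 : ⟪x2, y2⟫ = 0)
    (h01 : 0 < ⟪x0, y1⟫) (h02 : 0 < ⟪x0, y2⟫) (h10 : 0 < ⟪x1, y0⟫) (h12 : 0 < ⟪x1, y2⟫)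
    (h20 : 0 < ⟪x2, y0⟫) (h21 : 0 < ⟪x2, y1⟫) : False := by
  have hli : LinearIndependent ℝ ![x0, x1, x2] := by
    rw [Fintype.linearIndependent_iff]
    intro c hc
    simp only [Fin.sum_univ_three, Matrix.cons_val_zero, Matrix.cons_val_one, Matrix.cons_val_two,
      Matrix.head_cons, Matrix.tail_cons, Matrix.cons_val] at hc
    have e0 := congrArg (fun z => ⟪z, y0⟫) hc
    have e1 := congrArg (fun z => ⟪z, y1⟫) hc
    have e2 := congrArg (fun z => ⟪z, y2⟫) hc
    simp only [inner_add_left, real_inner_smul_left, inner_zero_left, h00, h11, h22, mul_zero,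
      zero_add, add_zero] at e0 e1 e2
    obtain ⟨r0, r1, r2⟩ := sign_aux h10 h20 h01 h21 h02 h12 e0 e1 e2
    intro i
    fin_cases i <;> assumption
  have hle : Submodule.span ℝ (Set.range ![x0, x1, x2]) ≤
      (Submodule.span ℝ (Set.range ![p, q]))ᗮ := by
    rw [Submodule.span_le]
    rintro _ ⟨i, rfl⟩
    rw [SetLike.mem_coe, Submodule.mem_orthogonal]
    intro u hu
    induction hu using Submodule.span_induction with
    | mem u hu =>
      obtain ⟨j, rfl⟩ := hu
      fin_cases i <;> fin_cases j <;> simpa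
    | zero => simp
    | add a b _ _ ha hb => rw [inner_add_left, ha, hb, add_zero]
    | smul c a _ ha => rw [real_inner_smul_left, ha, mul_zero]
  have h1 := Submodule.finrank_mono hle
  rw [finrank_span_eq_card hli] at h1
  have h2 := finrank_orth_of_linInd _ hpq
  simp at h1
  omega

lemma card_le_two {ι : Type*} (T : Finset ι) (x y : ι → EucSp 4) (p q : EucSp 4)
    (hpq : LinearIndependent ℝ ![p, q])
    (hp : ∀ i ∈ T, ⟪p, x i⟫ = 0) (hq : ∀ i ∈ T, ⟪q, x i⟫ = 0) (h0 : ∀ i ∈ T, ⟪x i, y i⟫ = 0)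
    (h1 : ∀ i ∈ T, ∀ j ∈ T, i ≠ j → 0 < ⟪x i, y j⟫) : T.card ≤ 2 := by
  by_contra hcon
  obtain ⟨a, b, c, ha, hb, hc, hab, hac, hbc⟩ := Finset.two_lt_card_iff.1 (not_le.1 hcon)
  exact three_vectors (x a) (x b) (x c) (y a) (y b) (y c) p q hpq (hp a ha) (hp b hb) (hp c hc)
    (hq a ha) (hq b hb) (hq c hc) (h0 a ha) (h0 b hb) (h0 c hc) (h1 a ha b hb hab)
    (h1 a ha c hc hac) (h1 b hb a ha hab.symm) (h1 b hb c hc hbc) (h1 c hc a ha hac.symm)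
    (h1 c hc b hb hbc.symm)

lemma inner_const_eq_zero {d : ℕ} {P : Set (EucSp d)} (hP : (interior P).Nonempty) {m : EucSp d}
    {c : ℝ} (h : ∀ x ∈ P, ⟪m, x⟫ = c) : m = 0 := by
  obtain ⟨x0, hx0⟩ := hP
  obtain ⟨ε, hε, hb⟩ := Metric.isOpen_iff.1 isOpen_interior x0 hx0
  by_contra hm
  have hn : 0 < ‖m‖ := norm_pos_iff.2 hm
  have h1 : x0 + (ε / 2 / ‖m‖) • m ∈ P := by
    apply interior_subset
    apply hb
    rw [Metric.mem_ball, dist_eq_norm, add_sub_cancel_left, norm_smul, Real.norm_of_nonneg (by positivity)]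
    rw [div_mul_cancel₀ _ hn.ne']; linarith
  have h2 := h _ h1
  rw [inner_add_right, h _ (interior_subset hx0), real_inner_smul_right, real_inner_self_eq_norm_sq] at h2
  have : 0 < ε / 2 / ‖m‖ * ‖m‖ ^ 2 := by positivity
  linarith

/-- Maximal proper faces of a four-polytope are three-dimensional. -/
lemma finrank_coatm {S P : Set (EucSp 4)} (hV : Vert S P) (hS : S.Finite)
    (hP : (interior P).Nonempty) (F : Faces P) (hF : Coatm F) (hne : F.1.Nonempty) :
    Module.finrank ℝ (affineSpan ℝ F.1).direction = 3 := by
  rw [direction_affineSpan]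
  obtain ⟨L, M, hLM, hFL⟩ := face_form F hne
  obtain ⟨s0, hs0S, hs0⟩ := hV.exists_mem hne
  have hconst : ∀ x ∈ F.1, ⟪L, x⟫ = M := fun x hx => by rw [hFL] at hx; exact hx.2
  have hL0 : L ≠ 0 := by
    rintro rfl
    apply hF.1
    rw [isMax_face, hFL]
    have := hconst s0 hs0
    simp only [inner_zero_left] at this ⊢
    simp [← this]
  have hub : Module.finrank ℝ (vectorSpan ℝ F.1) ≤ 3 := by
    have h1 : vectorSpan ℝ F.1 ≤ (Submodule.span ℝ (Set.range ![L]))ᗮ := by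
      rw [vectorSpan_def, Submodule.span_le]
      rintro _ ⟨x, hx, y, hy, rfl⟩
      simp only [Matrix.range_cons, Matrix.range_empty, Set.union_empty, SetLike.mem_coe]
      rw [Submodule.mem_orthogonal_singleton_iff_inner_right]
      simp [inner_sub_right, hconst x hx, hconst y hy]
    have h2 := finrank_orth_of_linInd ![L] (LinearIndependent.of_subsingleton 0 hL0)
    have := Submodule.finrank_mono h1
    omega
  by_contra hcon
  have hlt : Module.finrank ℝ (vectorSpan ℝ F.1) < 3 := lt_of_le_of_ne hub hcon
  have hex : ∃ m ∈ (vectorSpan ℝ F.1)ᗮ, m ∉ Submodule.span ℝ {L} := by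
    by_contra hh
    push Not at hh
    have h1 := Submodule.finrank_mono (show (vectorSpan ℝ F.1)ᗮ ≤ Submodule.span ℝ {L} from hh)
    rw [finrank_span_singleton hL0] at h1
    have h2 := Submodule.finrank_add_finrank_orthogonal (vectorSpan ℝ F.1)
    rw [finrank_euclideanSpace] at h2
    simp at h2
    omega
  obtain ⟨m0, hm0, hm0L⟩ := hex
  have hm00 : m0 ≠ 0 := by rintro rfl; exact hm0L (Submodule.zero_mem _)
  -- choose the sign of `m`
  have hex2 : ∃ m ∈ (vectorSpan ℝ F.1)ᗮ, m ∉ Submodule.span ℝ {L} ∧ ∃ s ∈ S, ⟪m, s0⟫ < ⟪m, s⟫ := by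
    by_contra hh
    push Not at hh
    have h1 := hV.le_of (hh m0 hm0 hm0L)
    have h2 := hV.le_of (hh (-m0) (Submodule.neg_mem _ hm0)
      (fun h => hm0L (by simpa using Submodule.neg_mem _ h)))
    refine hm00 (inner_const_eq_zero hP (c := ⟪m0, s0⟫) fun x hx => le_antisymm (h1 x hx) ?_)
    have := h2 x hx
    rw [inner_neg_left, inner_neg_left] at this
    linarith
  obtain ⟨m, hm, hmL, s1, hs1S, hs1⟩ := hex2
  have hmc : ∀ x ∈ F.1, ⟪m, x⟫ = ⟪m, s0⟫ := by
    intro x hx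
    have h1 : x -ᵥ s0 ∈ vectorSpan ℝ F.1 := vsub_mem_vectorSpan ℝ hx hs0
    have h2 := Submodule.inner_left_of_mem_orthogonal h1 hm
    rw [vsub_eq_sub, inner_sub_right] at h2
    linarith
  obtain ⟨s2, ⟨hs2S, hs2⟩, hmin⟩ := Set.exists_min_image {s ∈ S | ⟪m, s0⟫ < ⟪m, s⟫}
    (fun s => (M - ⟪L, s⟫) / (⟪m, s⟫ - ⟪m, s0⟫)) (hS.subset fun s hs => hs.1) ⟨s1, hs1S, hs1⟩
  set t := (M - ⟪L, s2⟫) / (⟪m, s2⟫ - ⟪m, s0⟫) with ht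
  have ht0 : 0 ≤ t := div_nonneg (sub_nonneg.2 (hLM _ (hV.sub hs2S))) (sub_nonneg.2 hs2.le)
  have hle : ∀ s ∈ S, ⟪L + t • m, s⟫ ≤ M + t * ⟪m, s0⟫ := by
    intro s hs
    rw [inner_add_left, real_inner_smul_left]
    have hMs := hLM s (hV.sub hs)
    by_cases hpos : ⟪m, s0⟫ < ⟪m, s⟫
    · have h1 := hmin s ⟨hs, hpos⟩
      have h1 : t ≤ (M - ⟪L, s⟫) / (⟪m, s⟫ - ⟪m, s0⟫) := h1
      rw [le_div_iff₀ (sub_pos.2 hpos)] at h1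
      linarith
    · have := mul_le_mul_of_nonneg_left (not_lt.1 hpos) ht0
      linarith
  have hFG : F < mkFace _ _ (hV.le_of hle) := by
    refine lt_of_le_of_ne (fun x hx => ⟨F.2.subset hx, ?_⟩) fun heq => ?_
    · rw [inner_add_left, real_inner_smul_left, hconst x hx, hmc x hx]
    · have h2 : s2 ∈ (mkFace _ _ (hV.le_of hle)).1 := by
        refine ⟨hV.sub hs2S, ?_⟩
        rw [inner_add_left, real_inner_smul_left]
        have : t * (⟪m, s2⟫ - ⟪m, s0⟫) = M - ⟪L, s2⟫ := div_mul_cancel₀ _ (sub_pos.2 hs2).ne'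
        linarith
      rw [← heq] at h2
      exact hs2.ne' (hmc _ h2)
  have hmax := (isMax_face _).1 (hF.2 _ hFG)
  have hz : L + t • m = 0 := inner_const_eq_zero hP (c := M + t * ⟪m, s0⟫) fun x hx => by
    rw [← hmax] at hx; exact hx.2
  have htne : t ≠ 0 := by
    intro h; rw [h, zero_smul, add_zero] at hz; exact hL0 hz
  apply hmL
  rw [Submodule.mem_span_singleton]
  refine ⟨-t⁻¹, ?_⟩
  rw [eq_neg_of_add_eq_zero_left hz, smul_neg, neg_smul, neg_neg, smul_smul, inv_mul_cancel₀ htne, one_smul]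

/-- The wedge of a facet at an edge. -/
lemma exists_wedge {S P : Set (EucSp 4)} (hV : Vert S P) (hS : S.Finite)
    (F e : Faces P) {s t : EucSp 4} (hs : s ∈ S) (ht : t ∈ S) (hst : s ≠ t)
    (hrk : Module.finrank ℝ (affineSpan ℝ F.1).direction = 3)
    (hFmax : ¬ IsMax F)
    (he : ∀ u ∈ S, u ∈ e.1 ↔ (u = s ∨ u = t)) (heF : e ≤ F) :
    ∃ n1 n2 : EucSp 4, ⟪n1, t - s⟫ = 0 ∧ ⟪n2, t - s⟫ = 0 ∧ LinearIndependent ℝ ![n1, n2] ∧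
      (∃ p ∈ F.1, ∃ r : ℝ, p - s = r • (t - s) + n1) ∧
      (∃ p ∈ F.1, ∃ r : ℝ, p - s = r • (t - s) + n2) ∧
      ∀ p ∈ S, p ∈ F.1 → ∃ r a b : ℝ, 0 ≤ a ∧ 0 ≤ b ∧ p - s = r • (t - s) + a • n1 + b • n2 := by
  have hse : s ∈ e.1 := (he s hs).2 (Or.inl rfl)
  have hte : t ∈ e.1 := (he t ht).2 (Or.inr rfl)
  have hsF := heF hse
  have htF := heF hte
  obtain ⟨LF, MF, hLF, hFL⟩ := face_form F ⟨s, hsF⟩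
  obtain ⟨Le, Me, hLe, heL⟩ := face_form e ⟨s, hse⟩
  set d := t - s with hd
  have hd0 : d ≠ 0 := sub_ne_zero.2 hst.symm
  have hdd : ⟪d, d⟫ ≠ 0 := inner_self_ne_zero.2 hd0
  have cF : ∀ x ∈ F.1, ⟪LF, x⟫ = MF := fun x hx => by rw [hFL] at hx; exact hx.2
  have ce : ∀ x ∈ e.1, ⟪Le, x⟫ = Me := fun x hx => by rw [heL] at hx; exact hx.2
  have hLFd : ⟪LF, d⟫ = 0 := by rw [hd, inner_sub_right, cF t htF, cF s hsF, sub_self]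
  have hLed : ⟪Le, d⟫ = 0 := by rw [hd, inner_sub_right, ce t hte, ce s hse, sub_self]
  have hLF0 : LF ≠ 0 := by
    rintro rfl
    apply hFmax
    rw [isMax_face, hFL]
    have := cF s hsF
    simp only [inner_zero_left] at this ⊢
    simp [← this]
  -- `F` is not contained in a plane
  have hbig : ∀ n : EucSp 4, ∃ p ∈ S, p ∈ F.1 ∧ p - s ∉ Submodule.span ℝ (Set.range ![d, n]) := by
    intro n
    by_contra hh
    push Not at hh
    set W := Submodule.span ℝ (Set.range ![d, n]) with hW
    have h1 : F.1 ⊆ (AffineSubspace.mk' s W : Set (EucSp 4)) := by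
      rw [hV.face_eq F]
      refine convexHull_min (fun p hp => ?_) (AffineSubspace.convex _)
      rw [SetLike.mem_coe, AffineSubspace.mem_mk']
      exact hh p hp.1 hp.2
    have h2 : (affineSpan ℝ F.1).direction ≤ W := by
      have := AffineSubspace.direction_le (affineSpan_le.2 h1)
      rwa [AffineSubspace.direction_mk'] at this
    have h3 := Submodule.finrank_mono h2
    have h4 : Module.finrank ℝ W ≤ 2 := by
      exact (finrank_range_le_card (R := ℝ) (b := ![d, n])).trans (by simp)
    omega
  have hne : ∀ p ∈ S, p ∉ e.1 → 0 < Me - ⟪Le, p⟫ := by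
    intro p hp hpe
    refine sub_pos.2 (lt_of_le_of_ne (hLe p (hV.sub hp)) fun h => hpe ?_)
    rw [heL]; exact ⟨hV.sub hp, h⟩
  have hTne : ∃ p, p ∈ S ∧ p ∈ F.1 ∧ p ∉ e.1 := by
    obtain ⟨p, hp, hpF, hpn⟩ := hbig 0
    refine ⟨p, hp, hpF, fun hpe => hpn ?_⟩
    rcases (he p hp).1 hpe with rfl | rfl
    · rw [sub_self]; exact Submodule.zero_mem _
    · exact Submodule.subset_span ⟨0, rfl⟩
  -- the coordinate along the facet
  have hk : ∃ k : EucSp 4, ∀ x : EucSp 4, ⟪d, x⟫ = 0 → ⟪LF, x⟫ = 0 → ⟪Le, x⟫ = 0 → ⟪k, x⟫ = 0 →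
      x = 0 := by
    have hli : LinearIndependent ℝ ![d, LF, Le] := by
      rw [Fintype.linearIndependent_iff]
      intro c hc
      simp only [Fin.sum_univ_three, Matrix.cons_val_zero, Matrix.cons_val_one, Matrix.cons_val] at hc
      have e0 := congrArg (fun z => ⟪z, d⟫) hc
      simp only [inner_add_left, real_inner_smul_left, inner_zero_left, hLFd, hLed, mul_zero,
        add_zero] at e0
      have c0 : c 0 = 0 := (mul_eq_zero.1 e0).resolve_right hdd
      obtain ⟨p, hp, hpF, hpe⟩ := hTne
      have e1 := congrArg (fun z => ⟪z, p - s⟫) hc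
      simp only [inner_add_left, real_inner_smul_left, inner_zero_left, c0, zero_mul, zero_add,
        inner_sub_right, cF p hpF, cF s hsF, sub_self, mul_zero, ce s hse] at e1
      have e1' : c 2 * (Me - ⟪Le, p⟫) = 0 := by linarith
      have c2 : c 2 = 0 := (mul_eq_zero.1 e1').resolve_right (hne p hp hpe).ne'
      rw [c0, c2, zero_smul, zero_smul, zero_add, add_zero] at hc
      have c1 : c 1 = 0 := (smul_eq_zero.1 hc).resolve_right hLF0
      intro i
      fin_cases i <;> assumption
    have h1 := finrank_orth_of_linInd _ hli
    have h2 : Module.finrank ℝ ((Submodule.span ℝ (Set.range ![d, LF, Le]))ᗮ :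
      Submodule ℝ (EucSp 4)) = 1 := by omega
    obtain ⟨k, -, hk⟩ := finrank_eq_one_iff'.1 h2
    refine ⟨k, fun x h1 h2 h3 h4 => ?_⟩
    have hx : x ∈ (Submodule.span ℝ (Set.range ![d, LF, Le]))ᗮ := by
      rw [Submodule.mem_orthogonal]
      intro u hu
      induction hu using Submodule.span_induction with
      | mem u hu =>
        obtain ⟨j, rfl⟩ := hu
        fin_cases j <;> simpa
      | zero => simp
      | add a b _ _ ha hb => rw [inner_add_left, ha, hb, add_zero]
      | smul c a _ ha => rw [real_inner_smul_left, ha, mul_zero]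
    obtain ⟨c, hc⟩ := hk ⟨x, hx⟩
    have hc' : c • (k : EucSp 4) = x := congrArg Subtype.val hc
    have : ⟪x, x⟫ = 0 := by
      nth_rewrite 1 [← hc']
      rw [real_inner_smul_left, h4, mul_zero]
    exact inner_self_eq_zero.1 this
  obtain ⟨k, hk⟩ := hk
  let τ : EucSp 4 → EucSp 4 := fun p => p - s - (⟪d, p - s⟫ / ⟪d, d⟫) • d
  have hτ : ∀ p, p - s = (⟪d, p - s⟫ / ⟪d, d⟫) • d + τ p := fun p => by simp [τ]
  have hτd : ∀ p, ⟪d, τ p⟫ = 0 := by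
    intro p
    simp only [τ]
    rw [inner_sub_right, real_inner_smul_right, div_mul_cancel₀ _ hdd, sub_self]
  have hτF : ∀ p ∈ F.1, ⟪LF, τ p⟫ = 0 := by
    intro p hp
    simp only [τ]
    rw [inner_sub_right, real_inner_smul_right, hLFd, inner_sub_right, cF p hp, cF s hsF]; ring
  have hτe : ∀ p, ⟪Le, τ p⟫ = -(Me - ⟪Le, p⟫) := by
    intro p
    simp only [τ]
    rw [inner_sub_right, real_inner_smul_right, hLed, inner_sub_right, ce s hse]; ring
  let H : EucSp 4 → ℝ := fun p => Me - ⟪Le, p⟫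
  let ρ : EucSp 4 → ℝ := fun p => ⟪k, τ p⟫ / H p
  have hfin : {p | p ∈ S ∧ p ∈ F.1 ∧ p ∉ e.1}.Finite := hS.subset fun p hp => hp.1
  obtain ⟨p1, ⟨hp1S, hp1F, hp1e⟩, hmin⟩ := Set.exists_min_image _ ρ hfin hTne
  obtain ⟨p2, ⟨hp2S, hp2F, hp2e⟩, hmax⟩ := Set.exists_max_image _ ρ hfin hTne
  have H1 : 0 < H p1 := hne _ hp1S hp1e
  have H2 : 0 < H p2 := hne _ hp2S hp2e
  have hkρ : ∀ p ∈ S, p ∉ e.1 → ⟪k, τ p⟫ = ρ p * H p := fun p hp hpe =>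
    (div_mul_cancel₀ _ (hne p hp hpe).ne').symm
  have hcomb : ∀ p ∈ S, p ∈ F.1 → p ∉ e.1 → ∀ a b : ℝ, a * H p1 + b * H p2 = H p →
      a * (ρ p1 * H p1) + b * (ρ p2 * H p2) = ρ p * H p → τ p = a • τ p1 + b • τ p2 := by
    intro p hp hpF hpe a b h1 h2
    rw [← sub_eq_zero]
    apply hk
    · simp [inner_sub_right, inner_add_right, real_inner_smul_right, hτd]
    · simp [inner_sub_right, inner_add_right, real_inner_smul_right, hτF p hpF, hτF p1 hp1F, hτF p2 hp2F]
    · rw [inner_sub_right, inner_add_right, real_inner_smul_right, real_inner_smul_right, hτe, hτe, hτe]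
      change -H p - (a * -H p1 + b * -H p2) = 0
      linarith
    · rw [inner_sub_right, inner_add_right, real_inner_smul_right, real_inner_smul_right,
        hkρ p hp hpe, hkρ p1 hp1S hp1e, hkρ p2 hp2S hp2e]
      linarith
  have hlt : ρ p1 < ρ p2 := by
    refine lt_of_le_of_ne (hmin p2 ⟨hp2S, hp2F, hp2e⟩) fun heq => ?_
    obtain ⟨p, hp, hpF, hpn⟩ := hbig (τ p1)
    apply hpn
    have hdm : d ∈ Submodule.span ℝ (Set.range ![d, τ p1]) := Submodule.subset_span ⟨0, rfl⟩
    have hnm : τ p1 ∈ Submodule.span ℝ (Set.range ![d, τ p1]) := Submodule.subset_span ⟨1, rfl⟩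
    by_cases hpe : p ∈ e.1
    · rcases (he p hp).1 hpe with rfl | rfl
      · rw [sub_self]; exact Submodule.zero_mem _
      · exact hdm
    · have hρ : ρ p = ρ p1 :=
        le_antisymm ((hmax p ⟨hp, hpF, hpe⟩).trans heq.ge) (hmin p ⟨hp, hpF, hpe⟩)
      have := hcomb p hp hpF hpe (H p / H p1) 0
        (by rw [div_mul_cancel₀ _ H1.ne']; ring) (by rw [hρ]; field_simp; ring)
      rw [hτ p, this, zero_smul, add_zero]
      exact Submodule.add_mem _ (Submodule.smul_mem _ _ hdm) (Submodule.smul_mem _ _ hnm)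
  refine ⟨τ p1, τ p2, ?_, ?_, ?_, ⟨p1, hp1F, _, hτ p1⟩, ⟨p2, hp2F, _, hτ p2⟩, ?_⟩
  · rw [real_inner_comm]; exact hτd p1
  · rw [real_inner_comm]; exact hτd p2
  · rw [LinearIndependent.pair_iff]
    intro x y hxy
    have e1 := congrArg (fun z => ⟪Le, z⟫) hxy
    have e2 := congrArg (fun z => ⟪k, z⟫) hxy
    simp only [inner_add_right, real_inner_smul_right, inner_zero_right, hτe,
      hkρ p1 hp1S hp1e, hkρ p2 hp2S hp2e] at e1 e2
    change x * -H p1 + y * -H p2 = 0 at e1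
    have h3 : x * (H p1 * (ρ p2 - ρ p1)) = 0 := by linear_combination -ρ p2 * e1 - e2
    have hx : x = 0 := (mul_eq_zero.1 h3).resolve_right (mul_pos H1 (sub_pos.2 hlt)).ne'
    refine ⟨hx, ?_⟩
    rw [hx] at e1
    have : y * H p2 = 0 := by linarith
    exact (mul_eq_zero.1 this).resolve_right H2.ne'
  · intro p hp hpF
    by_cases hpe : p ∈ e.1
    · rcases (he p hp).1 hpe with rfl | rfl
      · exact ⟨0, 0, 0, le_rfl, le_rfl, by simp⟩
      · exact ⟨1, 0, 0, le_rfl, le_rfl, by simp [hd]⟩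
    · have hHp : 0 < H p := hne p hp hpe
      have hD : 0 < ρ p2 - ρ p1 := sub_pos.2 hlt
      have hlo : 0 ≤ ρ p - ρ p1 := sub_nonneg.2 (hmin p ⟨hp, hpF, hpe⟩)
      have hhi : 0 ≤ ρ p2 - ρ p := sub_nonneg.2 (hmax p ⟨hp, hpF, hpe⟩)
      refine ⟨⟪d, p - s⟫ / ⟪d, d⟫, (ρ p2 - ρ p) / (ρ p2 - ρ p1) * H p / H p1, (ρ p - ρ p1) / (ρ p2 - ρ p1) * H p / H p2,
        by positivity, by positivity, ?_⟩
      rw [add_assoc, ← hcomb p hp hpF hpe _ _ ?_ ?_]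
      · exact hτ p
      · field_simp; ring
      · field_simp; ring

/-! ## Measure theory -/

lemma sum_measure_le_two {ι Ω : Type*} [MeasurableSpace Ω] (μ : MeasureTheory.Measure Ω)
    (T : Finset ι) (A : ι → Set Ω) (hA : ∀ i ∈ T, MeasurableSet (A i))
    (h : ∀ x, (T.filter fun i => x ∈ A i).card ≤ 2) :
    ∑ i ∈ T, μ (A i) ≤ 2 * μ Set.univ := by
  have h1 : ∑ i ∈ T, μ (A i) = ∑ i ∈ T, ∫⁻ x, (A i).indicator 1 x ∂μ :=
    Finset.sum_congr rfl fun i hi => (MeasureTheory.lintegral_indicator_one (hA i hi)).symm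
  rw [h1, ← MeasureTheory.lintegral_finsetSum' _ (fun i hi =>
    ((measurable_one.indicator (hA i hi)).aemeasurable))]
  calc ∫⁻ x, ∑ i ∈ T, (A i).indicator 1 x ∂μ ≤ ∫⁻ _, 2 ∂μ := by
        apply MeasureTheory.lintegral_mono
        intro x
        have : ∑ i ∈ T, (A i).indicator (1 : Ω → ENNReal) x
            = ((T.filter fun i => x ∈ A i).card : ENNReal) := by
          rw [Finset.card_filter, Nat.cast_sum]
          refine Finset.sum_congr rfl fun i _ => ?_
          by_cases hx : x ∈ A i <;> simp [hx]
        simp only [this]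
        exact_mod_cast h x
    _ = 2 * μ Set.univ := by rw [MeasureTheory.lintegral_const]

/-- Lebesgue measure on the unit ball of four-space. -/
noncomputable def muB : MeasureTheory.Measure (EucSp 4) :=
  MeasureTheory.volume.restrict (Metric.ball 0 1)

lemma muB_univ_ne_zero : muB Set.univ ≠ 0 := by
  rw [muB, MeasureTheory.Measure.restrict_apply_univ]
  exact (Metric.measure_ball_pos _ _ one_pos).ne'

lemma muB_univ_ne_top : muB Set.univ ≠ ⊤ := by
  rw [muB, MeasureTheory.Measure.restrict_apply_univ]
  exact MeasureTheory.measure_ball_lt_top.ne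

lemma muB_hyper {n : EucSp 4} (hn : n ≠ 0) : muB {g | ⟪g, n⟫ = 0} = 0 := by
  refine le_antisymm ((MeasureTheory.Measure.restrict_apply_le _ _).trans ?_) zero_le
  have h := MeasureTheory.Measure.addHaar_submodule (MeasureTheory.volume : MeasureTheory.Measure (EucSp 4))
    (Submodule.span ℝ {n})ᗮ (by
      intro htop
      have : n ∈ (Submodule.span ℝ {n})ᗮ := by rw [htop]; trivial
      rw [Submodule.mem_orthogonal_singleton_iff_inner_right] at this
      exact hn (inner_self_eq_zero.1 this))
  refine le_of_eq ?_
  rw [← h]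
  congr 1
  ext g
  rw [SetLike.mem_coe, Submodule.mem_orthogonal_singleton_iff_inner_left]
  rfl

lemma meas_neg (n1 n2 : EucSp 4) : MeasurableSet {g : EucSp 4 | ⟪g, n1⟫ * ⟪g, n2⟫ < 0} :=
  (isOpen_lt (by fun_prop) (by fun_prop)).measurableSet

lemma meas_pos (n1 n2 : EucSp 4) : MeasurableSet {g : EucSp 4 | 0 < ⟪g, n1⟫ * ⟪g, n2⟫} :=
  (isOpen_lt (by fun_prop) (by fun_prop)).measurableSet

lemma exists_rot {n1 n2 : EucSp 4} (h : LinearIndependent ℝ ![n1, n2]) :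
    ∃ J : EucSp 4 ≃ₗᵢ[ℝ] EucSp 4, ∀ g, ∃ a b : ℝ, ⟪a • n1 + b • n2, g⟫ = 0 ∧
      ⟪a • n1 + b • n2, n1⟫ = ⟪J g, n1⟫ ∧ ⟪a • n1 + b • n2, n2⟫ = ⟪J g, n2⟫ := by
  have hn1 : n1 ≠ 0 := h.ne_zero 0
  have hN1 : ‖n1‖ ≠ 0 := norm_ne_zero_iff.2 hn1
  obtain ⟨u1, hu1⟩ : ∃ u, u = ‖n1‖⁻¹ • n1 := ⟨_, rfl⟩
  obtain ⟨m, hm⟩ : ∃ m, m = n2 - ⟪u1, n2⟫ • u1 := ⟨_, rfl⟩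
  have hu1n : ‖u1‖ = 1 := by rw [hu1, norm_smul, norm_inv, norm_norm, inv_mul_cancel₀ hN1]
  have hu11 : ⟪u1, u1⟫ = 1 := by rw [real_inner_self_eq_norm_sq, hu1n]; norm_num
  have hm0 : m ≠ 0 := by
    intro h0
    rw [LinearIndependent.pair_iff] at h
    have := (h (-(⟪u1, n2⟫ * ‖n1‖⁻¹)) 1 (by
      rw [h0, hu1, smul_smul] at hm
      rw [one_smul, neg_smul, hu1, neg_add_eq_sub]
      exact hm.symm)).2
    norm_num at this
  have hM : ‖m‖ ≠ 0 := norm_ne_zero_iff.2 hm0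
  obtain ⟨u2, hu2⟩ : ∃ u, u = ‖m‖⁻¹ • m := ⟨_, rfl⟩
  have hu2n : ‖u2‖ = 1 := by rw [hu2, norm_smul, norm_inv, norm_norm, inv_mul_cancel₀ hM]
  have hu22 : ⟪u2, u2⟫ = 1 := by rw [real_inner_self_eq_norm_sq, hu2n]; norm_num
  have h12 : ⟪u1, u2⟫ = 0 := by
    rw [hu2, real_inner_smul_right, hm, inner_sub_right, real_inner_smul_right, hu11]; ring
  have h21 : ⟪u2, u1⟫ = 0 := by rw [real_inner_comm]; exact h12
  have e1 : n1 = ‖n1‖ • u1 := by rw [hu1, smul_smul, mul_inv_cancel₀ hN1, one_smul]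
  have e2 : n2 = ⟪u1, n2⟫ • u1 + ‖m‖ • u2 := by
    rw [hu2, smul_smul, mul_inv_cancel₀ hM, one_smul, hm]; abel
  -- the rotation
  let R1 := (Submodule.span ℝ {u1})ᗮ.reflection
  let R2 := (Submodule.span ℝ {u2 - u1})ᗮ.reflection
  have hR1 : ∀ x y, ⟪R1 x, y⟫ = ⟪x, R1 y⟫ := fun x y => by
    rw [← R1.inner_map_map x (R1 y), Submodule.reflection_reflection]
  have hR2 : ∀ x y, ⟪R2 x, y⟫ = ⟪x, R2 y⟫ := fun x y => by
    rw [← R2.inner_map_map x (R2 y), Submodule.reflection_reflection]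
  have r11 : R1 u1 = -u1 := Submodule.reflection_orthogonalComplement_singleton_eq_neg u1
  have r12 : R1 u2 = u2 := by
    apply Submodule.reflection_mem_subspace_eq_self
    rw [Submodule.mem_orthogonal_singleton_iff_inner_right]; exact h12
  have r22 : R2 u2 = u1 := Submodule.reflection_sub (by rw [hu1n, hu2n])
  have r21 : R2 u1 = u2 := by rw [← r22]; exact Submodule.reflection_reflection _ _
  have j1 : ∀ g, ⟪R1 (R2 g), u1⟫ = -⟪u2, g⟫ := fun g => by
    rw [hR1, hR2, r11, map_neg, r21, inner_neg_right, real_inner_comm]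
  have j2 : ∀ g, ⟪R1 (R2 g), u2⟫ = ⟪u1, g⟫ := fun g => by
    rw [hR1, hR2, r12, r22, real_inner_comm]
  refine ⟨R2.trans R1, fun g => ?_⟩
  have hw : ∃ a b : ℝ, a • n1 + b • n2 = (-⟪u2, g⟫) • u1 + ⟪u1, g⟫ • u2 := by
    refine ⟨(-⟪u2, g⟫ - ⟪u1, g⟫ * ‖m‖⁻¹ * ⟪u1, n2⟫) * ‖n1‖⁻¹, ⟪u1, g⟫ * ‖m‖⁻¹, ?_⟩
    have e3 : ∀ c : ℝ, c • n2 = c • (⟪u1, n2⟫ • u1 + ‖m‖ • u2) := fun c => by rw [← e2]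
    have e4 : ∀ c : ℝ, c • n1 = c • (‖n1‖ • u1) := fun c => by rw [← e1]
    rw [e3, e4]
    match_scalars
    · field_simp; ring
    · field_simp
  obtain ⟨a, b, hab⟩ := hw
  refine ⟨a, b, ?_, ?_, ?_⟩
  · rw [hab, inner_add_left, real_inner_smul_left, real_inner_smul_left]; ring
  · have : ∀ v : EucSp 4, ⟪v, n1⟫ = ‖n1‖ * ⟪v, u1⟫ := fun v => by
      conv_lhs => rw [e1, real_inner_smul_right]
    rw [hab, this, this, LinearIsometryEquiv.trans_apply, j1, inner_add_left, real_inner_smul_left,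
      real_inner_smul_left, hu11, h21]; ring
  · have : ∀ v : EucSp 4, ⟪v, n2⟫ = ⟪u1, n2⟫ * ⟪v, u1⟫ + ‖m‖ * ⟪v, u2⟫ := fun v => by
      conv_lhs => rw [e2, inner_add_right, real_inner_smul_right, real_inner_smul_right]
    rw [hab, this ((-⟪u2, g⟫) • u1 + ⟪u1, g⟫ • u2), this ((R2.trans R1) g),
      LinearIsometryEquiv.trans_apply, j1, j2, inner_add_left, real_inner_smul_left,
      real_inner_smul_left, inner_add_left, real_inner_smul_left,
      real_inner_smul_left, hu11, h21, h12, hu22]; ring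

lemma exists_dset_aux {n1 n2 : EucSp 4} (h : LinearIndependent ℝ ![n1, n2]) :
    ∃ D : Set (EucSp 4), MeasurableSet D ∧
      muB Set.univ ≤ muB {g : EucSp 4 | ⟪g, n1⟫ * ⟪g, n2⟫ < 0} + muB D ∧
      ∀ g ∈ D, ∃ a b : ℝ, ⟪a • n1 + b • n2, g⟫ = 0 ∧ 0 < ⟪a • n1 + b • n2, n1⟫ ∧
        0 < ⟪a • n1 + b • n2, n2⟫ := by
  obtain ⟨J, hJ⟩ := exists_rot h
  have hmJ : Measurable J := J.continuous.measurable
  refine ⟨J ⁻¹' {g : EucSp 4 | 0 < ⟪g, n1⟫ * ⟪g, n2⟫}, hmJ (meas_pos _ _), ?_, ?_⟩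
  · have hD : muB (J ⁻¹' {g : EucSp 4 | 0 < ⟪g, n1⟫ * ⟪g, n2⟫})
        = muB {g : EucSp 4 | 0 < ⟪g, n1⟫ * ⟪g, n2⟫} := by
      have hb : J ⁻¹' (Metric.ball 0 1) = Metric.ball 0 1 := by
        ext x; simp
      rw [muB, MeasureTheory.Measure.restrict_apply (hmJ (meas_pos _ _)),
        MeasureTheory.Measure.restrict_apply (meas_pos _ _)]
      nth_rewrite 1 [← hb]
      rw [← Set.preimage_inter]
      exact J.measurePreserving.measure_preimage
        ((meas_pos _ _).inter measurableSet_ball).nullMeasurableSet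
    rw [hD]
    have hsub : (Set.univ : Set (EucSp 4)) ⊆ ({g | ⟪g, n1⟫ * ⟪g, n2⟫ < 0} ∪
        {g | 0 < ⟪g, n1⟫ * ⟪g, n2⟫}) ∪ ({g | ⟪g, n1⟫ = 0} ∪ {g | ⟪g, n2⟫ = 0}) := by
      intro g _
      rcases lt_trichotomy (⟪g, n1⟫ * ⟪g, n2⟫) 0 with hh | hh | hh
      · exact Or.inl (Or.inl hh)
      · rcases mul_eq_zero.1 hh with hh | hh
        · exact Or.inr (Or.inl hh)
        · exact Or.inr (Or.inr hh)
      · exact Or.inl (Or.inr hh)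
    calc muB Set.univ ≤ _ := MeasureTheory.measure_mono hsub
      _ ≤ _ := MeasureTheory.measure_union_le _ _
      _ ≤ (muB _ + muB _) + (muB _ + muB _) :=
        add_le_add (MeasureTheory.measure_union_le _ _) (MeasureTheory.measure_union_le _ _)
      _ = _ := by
        rw [muB_hyper (n := n1) (h.ne_zero 0), muB_hyper (n := n2) (h.ne_zero 1), add_zero, add_zero]
  · intro g hg
    obtain ⟨a, b, h1, h2, h3⟩ := hJ g
    have hg' : 0 < ⟪J g, n1⟫ * ⟪J g, n2⟫ := hg
    rcases mul_pos_iff.1 hg' with ⟨hp, hq⟩ | ⟨hp, hq⟩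
    · exact ⟨a, b, h1, by rwa [h2], by rwa [h3]⟩
    · refine ⟨-a, -b, ?_, ?_, ?_⟩ <;>
        rw [neg_smul, neg_smul, ← neg_add, inner_neg_left]
      · rw [h1, neg_zero]
      · rw [h2]; linarith
      · rw [h3]; linarith

lemma exists_dset {n1 n2 : EucSp 4} (h : LinearIndependent ℝ ![n1, n2]) :
    ∃ D : Set (EucSp 4), MeasurableSet D ∧
      muB Set.univ ≤ muB {g : EucSp 4 | ⟪g, n1⟫ * ⟪g, n2⟫ < 0} + muB D ∧
      ∀ g ∈ D, ⟪g, n1⟫ ≠ 0 ∧ ∃ a b : ℝ, ⟪a • n1 + b • n2, g⟫ = 0 ∧ 0 < ⟪a • n1 + b • n2, n1⟫ ∧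
        0 < ⟪a • n1 + b • n2, n2⟫ := by
  obtain ⟨D, h1, h2, h3⟩ := exists_dset_aux h
  refine ⟨D \ {g | ⟪g, n1⟫ = 0}, h1.diff ?_, ?_, fun g hg => ⟨hg.2, h3 g hg.1⟩⟩
  · exact (isClosed_eq (by fun_prop) (by fun_prop)).measurableSet
  · rwa [MeasureTheory.measure_sdiff_null (muB_hyper (n := n1) (h.ne_zero 0))]

/-! ## The core counting argument -/

/-- `n1`, `n2` span the wedge of `F` along the edge from `s` to `t`. -/
def IsWedge (S F : Set (EucSp 4)) (s t n1 n2 : EucSp 4) : Prop :=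
  ⟪n1, t - s⟫ = 0 ∧ ⟪n2, t - s⟫ = 0 ∧ LinearIndependent ℝ ![n1, n2] ∧
      (∃ p ∈ F, ∃ r : ℝ, p - s = r • (t - s) + n1) ∧
      (∃ p ∈ F, ∃ r : ℝ, p - s = r • (t - s) + n2) ∧
      ∀ p ∈ S, p ∈ F → ∃ r a b : ℝ, 0 ≤ a ∧ 0 ≤ b ∧ p - s = r • (t - s) + a • n1 + b • n2

lemma IsWedge.symm {S F : Set (EucSp 4)} {s t n1 n2 : EucSp 4} (h : IsWedge S F s t n1 n2) :
    IsWedge S F t s n1 n2 := by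
  obtain ⟨h1, h2, h3, ⟨p1, hp1, r1, hr1⟩, ⟨p2, hp2, r2, hr2⟩, h6⟩ := h
  refine ⟨?_, ?_, h3, ⟨p1, hp1, 1 - r1, ?_⟩, ⟨p2, hp2, 1 - r2, ?_⟩, fun p hp hpF => ?_⟩
  · rw [← neg_sub, inner_neg_right, h1, neg_zero]
  · rw [← neg_sub, inner_neg_right, h2, neg_zero]
  · rw [show p1 - t = (p1 - s) - (t - s) by abel, hr1]; module
  · rw [show p2 - t = (p2 - s) - (t - s) by abel, hr2]; module
  · obtain ⟨r, a, b, ha, hb, hh⟩ := h6 p hp hpF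
    refine ⟨1 - r, a, b, ha, hb, ?_⟩
    rw [show p - t = (p - s) - (t - s) by abel, hh]; module

lemma lem1 {S P : Set (EucSp 4)} (hV : Vert S P) (e : Faces P) {s t : EucSp 4}
    (hs : s ∈ e.1) (ht : t ∈ e.1) (hst : s ≠ t) (T : Finset (Faces P × Faces P))
    (N1 N2 : Faces P × Faces P → EucSp 4) (g : EucSp 4)
    (hT : ∀ i ∈ T, i.1 = e ∧ Coatm i.2 ∧ e ≤ i.2 ∧ IsWedge S i.2.1 s t (N1 i) (N2 i) ∧
      ⟪g, N1 i⟫ * ⟪g, N2 i⟫ < 0) : T.card ≤ 2 := by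
  rcases T.eq_empty_or_nonempty with rfl | ⟨i0, hi0⟩
  · simp
  have hd0 : t - s ≠ 0 := sub_ne_zero.2 hst.symm
  have key : ∀ i, ∃ x y : EucSp 4, i ∈ T → ⟪t - s, x⟫ = 0 ∧ ⟪g, x⟫ = 0 ∧ ⟪x, y⟫ = 0 ∧
      (∃ α β : ℝ, 0 < α ∧ 0 < β ∧ x = α • N1 i + β • N2 i) ∧
      (∃ M, (∀ z ∈ P, ⟪-y, z⟫ ≤ M) ∧ i.2.1 = {z ∈ P | ⟪-y, z⟫ = M}) := by
    intro i
    by_cases hi : i ∈ T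
    · obtain ⟨h1, h2, h3, ⟨w1, w2, w3, ⟨p1, hp1, r1, hr1⟩, ⟨p2, hp2, r2, hr2⟩, w6⟩, h5⟩ := hT i hi
      obtain ⟨L, M, hL, hF⟩ := face_form i.2 ⟨s, h3 hs⟩
      have c : ∀ z ∈ i.2.1, ⟪L, z⟫ = M := fun z hz => by rw [hF] at hz; exact hz.2
      have hLd : ⟪L, t - s⟫ = 0 := by rw [inner_sub_right, c t (h3 ht), c s (h3 hs), sub_self]
      have l1 : ⟪L, N1 i⟫ = 0 := by
        have := congrArg (fun z => ⟪L, z⟫) hr1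
        simp only [inner_sub_right L p1 s, inner_add_right, real_inner_smul_right, c p1 hp1, c s (h3 hs), hLd] at this
        linarith
      have l2 : ⟪L, N2 i⟫ = 0 := by
        have := congrArg (fun z => ⟪L, z⟫) hr2
        simp only [inner_sub_right L p2 s, inner_add_right, real_inner_smul_right, c p2 hp2, c s (h3 hs), hLd] at this
        linarith
      have hab : ∃ α β : ℝ, 0 < α ∧ 0 < β ∧ α * ⟪g, N1 i⟫ + β * ⟪g, N2 i⟫ = 0 := by
        rcases mul_neg_iff.1 h5 with ⟨ha, hb⟩ | ⟨ha, hb⟩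
        · exact ⟨-⟪g, N2 i⟫, ⟪g, N1 i⟫, by linarith, ha, by ring⟩
        · exact ⟨⟪g, N2 i⟫, -⟪g, N1 i⟫, hb, by linarith, by ring⟩
      obtain ⟨α, β, hα, hβ, hαβ⟩ := hab
      refine ⟨α • N1 i + β • N2 i, -L, fun _ => ⟨?_, ?_, ?_, ⟨α, β, hα, hβ, rfl⟩, M, ?_, ?_⟩⟩
      · rw [real_inner_comm, inner_add_left, real_inner_smul_left, real_inner_smul_left, w1, w2]; ring
      · rw [inner_add_right, real_inner_smul_right, real_inner_smul_right, hαβ]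
      · rw [real_inner_comm, inner_neg_left, inner_add_right, real_inner_smul_right,
          real_inner_smul_right, l1, l2]; ring
      · simpa using hL
      · simpa using hF
    · exact ⟨0, 0, fun h => absurd h hi⟩
  choose x y hxy using key
  refine card_le_two T x y (t - s) g ?_ (fun i hi => (hxy i hi).1) (fun i hi => (hxy i hi).2.1)
    (fun i hi => (hxy i hi).2.2.1) ?_
  · obtain ⟨-, -, -, ⟨w1, -⟩, h5⟩ := hT i0 hi0
    rw [LinearIndependent.pair_iff]
    intro a b hab
    have h1 := congrArg (fun z => ⟪z, N1 i0⟫) hab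
    simp only [inner_add_left, real_inner_smul_left, inner_zero_left] at h1
    rw [real_inner_comm, w1] at h1
    have hg : ⟪g, N1 i0⟫ ≠ 0 := by intro h; rw [h, zero_mul] at h5; exact lt_irrefl _ h5
    have hb : b = 0 := by
      have : b * ⟪g, N1 i0⟫ = 0 := by linarith
      exact (mul_eq_zero.1 this).resolve_right hg
    rw [hb, zero_smul, add_zero] at hab
    exact ⟨(smul_eq_zero.1 hab).resolve_right hd0, hb⟩
  · intro i hi j hj hij
    obtain ⟨-, -, -, ⟨α, β, hα, hβ, hx⟩, -⟩ := hxy i hi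
    obtain ⟨-, -, -, -, M, hM, hjF⟩ := hxy j hj
    obtain ⟨hi1, hi2, hi3, ⟨w1, w2, w3, ⟨p1, hp1, r1, hr1⟩, ⟨p2, hp2, r2, hr2⟩, w6⟩, -⟩ := hT i hi
    obtain ⟨hj1, hj2, hj3, -⟩ := hT j hj
    set L := -y j with hL
    have c : ∀ z ∈ j.2.1, ⟪L, z⟫ = M := fun z hz => by rw [hjF] at hz; exact hz.2
    have hLd : ⟪L, t - s⟫ = 0 := by rw [inner_sub_right, c t (hj3 ht), c s (hj3 hs), sub_self]
    have l1 : ⟪L, p1⟫ - M = ⟪L, N1 i⟫ := by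
      have := congrArg (fun z => ⟪L, z⟫) hr1
      simp only [inner_sub_right L p1 s, inner_add_right, real_inner_smul_right, c s (hj3 hs), hLd] at this
      linarith
    have l2 : ⟪L, p2⟫ - M = ⟪L, N2 i⟫ := by
      have := congrArg (fun z => ⟪L, z⟫) hr2
      simp only [inner_sub_right L p2 s, inner_add_right, real_inner_smul_right, c s (hj3 hs), hLd] at this
      linarith
    have l1' : ⟪L, N1 i⟫ ≤ 0 := by have := hM p1 (i.2.2.subset hp1); linarith
    have l2' : ⟪L, N2 i⟫ ≤ 0 := by have := hM p2 (i.2.2.subset hp2); linarith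
    have hval : ⟪x i, y j⟫ = -(α * ⟪L, N1 i⟫ + β * ⟪L, N2 i⟫) := by
      rw [show y j = -L by simp [hL], inner_neg_right, hx, real_inner_comm, inner_add_right,
        real_inner_smul_right, real_inner_smul_right]
    rw [hval]
    have t1 := mul_nonpos_of_nonneg_of_nonpos hα.le l1'
    have t2 := mul_nonpos_of_nonneg_of_nonpos hβ.le l2'
    rcases lt_or_eq_of_le (add_nonpos t1 t2) with hlt | heq
    · linarith
    · exfalso
      have z1 : ⟪L, N1 i⟫ = 0 :=
        (mul_eq_zero.1 (show α * ⟪L, N1 i⟫ = 0 by linarith)).resolve_left hα.ne'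
      have z2 : ⟪L, N2 i⟫ = 0 :=
        (mul_eq_zero.1 (show β * ⟪L, N2 i⟫ = 0 by linarith)).resolve_left hβ.ne'
      have hle : i.2 ≤ j.2 := by
        rw [hV.le_iff]
        intro p hp hpF
        obtain ⟨r, a, b, -, -, hh⟩ := w6 p hp hpF
        rw [hjF]
        refine ⟨hV.sub hp, ?_⟩
        have := congrArg (fun z => ⟪L, z⟫) hh
        simp only [inner_sub_right L p s, inner_add_right, real_inner_smul_right, c s (hj3 hs), hLd, z1, z2] at this
        linarith
      rcases eq_or_lt_of_le hle with h | h
      · exact hij (Prod.ext (hi1.trans hj1.symm) h)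
      · exact hj2.1 (hi2.2 _ h)

lemma lem2 {S P : Set (EucSp 4)} (hV : Vert S P) (F : Faces P) (hF : ¬ IsMax F) {v : EucSp 4}
    (hv : v ∈ F.1) (T : Finset (Faces P × Faces P))
    (N1 N2 : Faces P × Faces P → EucSp 4) (o : Faces P × Faces P → EucSp 4) (g : EucSp 4)
    (hT : ∀ i ∈ T, i.2 = F ∧ i.1 ≤ F ∧ o i ∈ S ∧ v ≠ o i ∧ (∀ u ∈ S, u ∈ i.1.1 ↔ (u = v ∨ u = o i)) ∧
      v ∈ S ∧ IsWedge S F.1 v (o i) (N1 i) (N2 i) ∧ ⟪g, N1 i⟫ ≠ 0 ∧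
      ∃ a b : ℝ, ⟪a • N1 i + b • N2 i, g⟫ = 0 ∧ 0 < ⟪a • N1 i + b • N2 i, N1 i⟫ ∧
        0 < ⟪a • N1 i + b • N2 i, N2 i⟫) : T.card ≤ 2 := by
  rcases T.eq_empty_or_nonempty with rfl | ⟨i0, hi0⟩
  · simp
  obtain ⟨L, M, hL, hFL⟩ := face_form F ⟨v, hv⟩
  have c : ∀ z ∈ F.1, ⟪L, z⟫ = M := fun z hz => by rw [hFL] at hz; exact hz.2
  have hL0 : L ≠ 0 := by
    rintro rfl
    apply hF
    rw [isMax_face, hFL]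
    have := c v hv
    simp only [inner_zero_left] at this ⊢
    simp [← this]
  have hoF : ∀ i ∈ T, o i ∈ F.1 := fun i hi => by
    obtain ⟨h1, h2, h3, h4, h5, -⟩ := hT i hi
    exact h2 ((h5 _ h3).2 (Or.inr rfl))
  have hLN : ∀ i ∈ T, ⟪L, N1 i⟫ = 0 ∧ ⟪L, N2 i⟫ = 0 := by
    intro i hi
    obtain ⟨h1, h2, h3, h4, h5, -, ⟨w1, w2, w3, ⟨p1, hp1, r1, hr1⟩, ⟨p2, hp2, r2, hr2⟩, w6⟩, -⟩ := hT i hi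
    have hLd : ⟪L, o i - v⟫ = 0 := by rw [inner_sub_right, c _ (hoF i hi), c v hv, sub_self]
    constructor
    · have := congrArg (fun z => ⟪L, z⟫) hr1
      simp only [inner_sub_right L p1 v, inner_add_right, real_inner_smul_right, c p1 hp1, c v hv, hLd] at this
      linarith
    · have := congrArg (fun z => ⟪L, z⟫) hr2
      simp only [inner_sub_right L p2 v, inner_add_right, real_inner_smul_right, c p2 hp2, c v hv, hLd] at this
      linarith
  have key : ∀ i, ∃ x : EucSp 4, i ∈ T → ⟪x, g⟫ = 0 ∧ 0 < ⟪x, N1 i⟫ ∧ 0 < ⟪x, N2 i⟫ ∧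
      ⟪L, x⟫ = 0 ∧ ⟪x, o i - v⟫ = 0 := by
    intro i
    by_cases hi : i ∈ T
    · obtain ⟨-, -, -, -, -, -, ⟨w1, w2, -⟩, -, a, b, h1, h2, h3⟩ := hT i hi
      refine ⟨a • N1 i + b • N2 i, fun _ => ⟨h1, h2, h3, ?_, ?_⟩⟩
      · rw [inner_add_right, real_inner_smul_right, real_inner_smul_right, (hLN i hi).1, (hLN i hi).2]; ring
      · rw [inner_add_left, real_inner_smul_left, real_inner_smul_left, w1, w2]; ring
    · exact ⟨0, fun h => absurd h hi⟩
  choose x hx using key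
  refine card_le_two T x (fun i => o i - v) L g ?_ (fun i hi => (hx i hi).2.2.2.1)
    (fun i hi => by rw [real_inner_comm]; exact (hx i hi).1)
    (fun i hi => (hx i hi).2.2.2.2) ?_
  · obtain ⟨-, -, -, -, -, -, -, hg, -⟩ := hT i0 hi0
    rw [LinearIndependent.pair_iff]
    intro a b hab
    have h1 := congrArg (fun z => ⟪z, N1 i0⟫) hab
    simp only [inner_add_left, real_inner_smul_left, inner_zero_left, (hLN i0 hi0).1] at h1
    have hb : b = 0 := by
      have : b * ⟪g, N1 i0⟫ = 0 := by linarith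
      exact (mul_eq_zero.1 this).resolve_right hg
    rw [hb, zero_smul, add_zero] at hab
    exact ⟨(smul_eq_zero.1 hab).resolve_right hL0, hb⟩
  · intro i hi j hj hij
    obtain ⟨-, x1, x2, -, x3⟩ := hx i hi
    obtain ⟨hi1, hi2, hi3, hi4, hi5, hvS, ⟨w1, w2, w3, -, -, w6⟩, -⟩ := hT i hi
    obtain ⟨hj1, hj2, hj3, hj4, hj5, -⟩ := hT j hj
    obtain ⟨r, a, b, ha, hb, hh⟩ := w6 (o j) hj3 (hoF j hj)
    have hval : ⟪x i, o j - v⟫ = a * ⟪x i, N1 i⟫ + b * ⟪x i, N2 i⟫ := by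
      rw [hh, inner_add_right, inner_add_right, real_inner_smul_right, real_inner_smul_right,
        real_inner_smul_right, x3]; ring
    change 0 < ⟪x i, o j - v⟫
    rw [hval]
    have t1 := mul_nonneg ha x1.le
    have t2 := mul_nonneg hb x2.le
    rcases lt_or_eq_of_le (add_nonneg t1 t2) with hlt | heq
    · exact hlt
    · exfalso
      have z1 : a = 0 :=
        (mul_eq_zero.1 (show a * ⟪x i, N1 i⟫ = 0 by linarith)).resolve_right x1.ne'
      have z2 : b = 0 :=
        (mul_eq_zero.1 (show b * ⟪x i, N2 i⟫ = 0 by linarith)).resolve_right x2.ne'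
      rw [z1, z2, zero_smul, zero_smul, add_zero, add_zero] at hh
      have hve : v ∈ i.1.1 := (hi5 v hvS).2 (Or.inl rfl)
      have hoe : o i ∈ i.1.1 := (hi5 _ hi3).2 (Or.inr rfl)
      have hmem : o j ∈ i.1.1 := by
        obtain ⟨Le, Me, h1, h2⟩ := face_form i.1 ⟨v, hve⟩
        have ce : ∀ z ∈ i.1.1, ⟪Le, z⟫ = Me := fun z hz => by rw [h2] at hz; exact hz.2
        rw [h2]
        refine ⟨hV.sub hj3, ?_⟩
        have := congrArg (fun z => ⟪Le, z⟫) hh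
        simp only [inner_sub_right, real_inner_smul_right, ce v hve, ce _ hoe, sub_self, mul_zero] at this
        linarith
      have hoo : o j = o i := ((hi5 _ hj3).1 hmem).resolve_left hj4.symm
      apply hij
      refine Prod.ext (hV.eq_iff.2 fun u hu => ?_) (hi1.trans hj1.symm)
      rw [hi5 u hu, hj5 u hu, hoo]

lemma fiber_sum {ι κ : Type*} [DecidableEq κ] (N : Finset ι) (f : ι → κ) (c : ι → ℝ) (m : ℝ) (hm : 0 ≤ m) (k : ℕ)
    (h1 : ∀ i ∈ N, k ≤ (N.filter fun j => f j = f i).card)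
    (h2 : ∀ i ∈ N, ∑ j ∈ N.filter (fun j => f j = f i), c j ≤ 2 * m) :
    k * ∑ i ∈ N, c i ≤ 2 * N.card * m := by
  rw [← Finset.sum_fiberwise_of_maps_to (g := f) (t := N.image f)
    (fun i hi => Finset.mem_image_of_mem f hi),
    Finset.card_eq_sum_card_fiberwise (f := f) (t := N.image f)
    (fun i hi => Finset.mem_image_of_mem f hi), Finset.mul_sum, Nat.cast_sum, Finset.mul_sum,
    Finset.sum_mul]
  refine Finset.sum_le_sum fun b hb => ?_
  obtain ⟨i, hi, rfl⟩ := Finset.mem_image.1 hb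
  have a1 := h2 i hi
  have a2 : (k : ℝ) ≤ ((N.filter fun j => f j = f i).card : ℝ) := by exact_mod_cast h1 i hi
  calc (k : ℝ) * _ ≤ k * (2 * m) := mul_le_mul_of_nonneg_left a1 (Nat.cast_nonneg k)
    _ ≤ _ := by nlinarith [mul_le_mul_of_nonneg_right a2 hm]

lemma toReal_sum_le {ι : Type*} (T : Finset ι) (A : ι → Set (EucSp 4))
    (hA : ∀ i ∈ T, MeasurableSet (A i))
    (h : ∀ x, (T.filter fun i => x ∈ A i).card ≤ 2) :
    ∑ i ∈ T, (muB (A i)).toReal ≤ 2 * (muB Set.univ).toReal := by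
  have hfin : ∀ B : Set (EucSp 4), muB B ≠ ⊤ := fun B =>
    ne_top_of_le_ne_top muB_univ_ne_top (MeasureTheory.measure_mono (Set.subset_univ B))
  rw [← ENNReal.toReal_sum (fun i _ => hfin _)]
  have := ENNReal.toReal_mono (ENNReal.mul_ne_top (by norm_num) muB_univ_ne_top)
    (sum_measure_le_two muB T A hA h)
  rwa [ENNReal.toReal_mul] at this

theorem core {S P : Set (EucSp 4)} (hV : Vert S P) (hS : S.Finite) (hP : (interior P).Nonempty)
    (h4 : ∀ e : Faces P, Edg e → ∃ g : Fin 4 → Faces P, Function.Injective g ∧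
      ∀ i, Coatm (g i) ∧ e ≤ g i)
    (h5 : ∀ F : Faces P, Coatm F → F.1.Nonempty → ∃ f : Faces P → Faces P, ∀ e, Edg e → e ≤ F →
      Atm (f e) ∧ f e ≤ e ∧ ∃ g : Fin 5 → Faces P, Function.Injective g ∧
        ∀ i, Edg (g i) ∧ g i ≤ F ∧ f (g i) = f e)
    (hex : ∃ e F : Faces P, Edg e ∧ Coatm F ∧ e ≤ F) : False := by
  have hfinF := hV.finite hS
  let _ : Fintype (Faces P) := Fintype.ofFinite _
  -- end points
  have hE : ∀ e : Faces P, ∃ s t, Edg e → s ∈ S ∧ t ∈ S ∧ s ≠ t ∧ ∀ u ∈ S, u ∈ e.1 ↔ (u = s ∨ u = t) := by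
    intro e
    by_cases he : Edg e
    · obtain ⟨s, t, h⟩ := (hV.edg_iff e).1 he
      exact ⟨s, t, fun _ => h⟩
    · exact ⟨0, 0, fun h => absurd h he⟩
  choose s t hst using hE
  have hsE : ∀ e, Edg e → s e ∈ e.1 := fun e he =>
    ((hst e he).2.2.2 _ (hst e he).1).2 (Or.inl rfl)
  have htE : ∀ e, Edg e → t e ∈ e.1 := fun e he =>
    ((hst e he).2.2.2 _ (hst e he).2.1).2 (Or.inr rfl)
  let N : Finset (Faces P × Faces P) :=
    Finset.univ.filter fun i => Edg i.1 ∧ Coatm i.2 ∧ i.1 ≤ i.2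
  have hN : ∀ i, i ∈ N ↔ Edg i.1 ∧ Coatm i.2 ∧ i.1 ≤ i.2 := fun i => by simp [N]
  have hW : ∀ i : Faces P × Faces P, ∃ n1 n2 : EucSp 4, ∃ D : Set (EucSp 4), i ∈ N →
      IsWedge S i.2.1 (s i.1) (t i.1) n1 n2 ∧ MeasurableSet D ∧
      muB Set.univ ≤ muB {g : EucSp 4 | ⟪g, n1⟫ * ⟪g, n2⟫ < 0} + muB D ∧
      ∀ g ∈ D, ⟪g, n1⟫ ≠ 0 ∧ ∃ a b : ℝ, ⟪a • n1 + b • n2, g⟫ = 0 ∧ 0 < ⟪a • n1 + b • n2, n1⟫ ∧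
        0 < ⟪a • n1 + b • n2, n2⟫ := by
    intro i
    by_cases hi : i ∈ N
    · obtain ⟨h1, h2, h3⟩ := (hN i).1 hi
      obtain ⟨q1, q2, q3, q4⟩ := hst i.1 h1
      obtain ⟨n1, n2, hw⟩ := exists_wedge hV hS i.2 i.1 q1 q2 q3
        (finrank_coatm hV hS hP i.2 h2 ⟨s i.1, h3 (hsE _ h1)⟩) h2.1 q4 h3
      have hw : IsWedge S i.2.1 (s i.1) (t i.1) n1 n2 := hw
      obtain ⟨D, hD⟩ := exists_dset hw.2.2.1
      exact ⟨n1, n2, D, fun _ => ⟨hw, hD⟩⟩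
    · exact ⟨0, 0, ∅, fun h => absurd h hi⟩
  choose N1 N2 D hW using hW
  have hf : ∀ F : Faces P, ∃ f : Faces P → Faces P, Coatm F → ∀ e, Edg e → e ≤ F →
      Atm (f e) ∧ f e ≤ e ∧ ∃ g : Fin 5 → Faces P, Function.Injective g ∧
        ∀ i, Edg (g i) ∧ g i ≤ F ∧ f (g i) = f e := by
    intro F
    by_cases hF : Coatm F ∧ F.1.Nonempty
    · obtain ⟨f, hf⟩ := h5 F hF.1 hF.2
      exact ⟨f, fun _ => hf⟩
    · exact ⟨id, fun h1 e he hle => absurd ⟨h1, ⟨_, hle (hsE e he)⟩⟩ hF⟩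
  choose f hf using hf
  let m := (muB Set.univ).toReal
  have hm : 0 < m := ENNReal.toReal_pos muB_univ_ne_zero muB_univ_ne_top
  let c : Faces P × Faces P → ℝ := fun i => (muB {g : EucSp 4 | ⟪g, N1 i⟫ * ⟪g, N2 i⟫ < 0}).toReal
  let dd : Faces P × Faces P → ℝ := fun i => (muB (D i)).toReal
  have hfin : ∀ B : Set (EucSp 4), muB B ≠ ⊤ := fun B =>
    ne_top_of_le_ne_top muB_univ_ne_top (MeasureTheory.measure_mono (Set.subset_univ B))
  have hsum : N.card * m ≤ ∑ i ∈ N, c i + ∑ i ∈ N, dd i := by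
    rw [← Finset.sum_add_distrib, ← nsmul_eq_mul]
    refine Finset.card_nsmul_le_sum _ _ _ fun i hi => ?_
    have := (hW i hi).2.2.1
    have := ENNReal.toReal_mono (ENNReal.add_ne_top.2 ⟨hfin _, hfin _⟩) this
    rwa [ENNReal.toReal_add (hfin _) (hfin _)] at this
  have hc : (4 : ℕ) * ∑ i ∈ N, c i ≤ 2 * N.card * m := by
    refine fiber_sum N Prod.fst c m hm.le 4 ?_ ?_
    · intro i hi
      obtain ⟨h1, h2, h3⟩ := (hN i).1 hi
      obtain ⟨g, hg, hg'⟩ := h4 i.1 h1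
      have : (Finset.univ.image fun k => (i.1, g k)) ⊆ N.filter fun j => j.1 = i.1 := by
        intro j hj
        obtain ⟨k, -, rfl⟩ := Finset.mem_image.1 hj
        rw [Finset.mem_filter, hN]
        exact ⟨⟨h1, hg' k⟩, rfl⟩
      refine le_trans (le_of_eq ?_) (Finset.card_le_card this)
      rw [Finset.card_image_of_injective _ fun a b hab => hg (congrArg Prod.snd hab)]; simp
    · intro i hi
      obtain ⟨h1, h2, h3⟩ := (hN i).1 hi
      refine toReal_sum_le _ (fun i => {g : EucSp 4 | ⟪g, N1 i⟫ * ⟪g, N2 i⟫ < 0})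
        (fun j _ => meas_neg _ _) fun g => ?_
      refine lem1 hV i.1 (hsE _ h1) (htE _ h1) (hst _ h1).2.2.1 _ N1 N2 g fun j hj => ?_
      obtain ⟨hj, hjg⟩ := Finset.mem_filter.1 hj
      obtain ⟨hjN, hji⟩ := Finset.mem_filter.1 hj
      obtain ⟨j1, j2, j3⟩ := (hN j).1 hjN
      have hw := (hW j hjN).1
      rw [hji] at hw j3
      exact ⟨hji, j2, j3, hw, hjg⟩
  have hd : (5 : ℕ) * ∑ i ∈ N, dd i ≤ 2 * N.card * m := by
    refine fiber_sum N (fun i => (i.2, f i.2 i.1)) dd m hm.le 5 ?_ ?_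
    · intro i hi
      obtain ⟨h1, h2, h3⟩ := (hN i).1 hi
      obtain ⟨-, -, g, hg, hg'⟩ := hf i.2 h2 i.1 h1 h3
      have : (Finset.univ.image fun k => (g k, i.2)) ⊆
          N.filter fun j => (j.2, f j.2 j.1) = (i.2, f i.2 i.1) := by
        intro j hj
        obtain ⟨k, -, rfl⟩ := Finset.mem_image.1 hj
        rw [Finset.mem_filter, hN]
        refine ⟨⟨(hg' k).1, h2, (hg' k).2.1⟩, ?_⟩
        simp only [(hg' k).2.2]
      refine le_trans (le_of_eq ?_) (Finset.card_le_card this)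
      rw [Finset.card_image_of_injective _ fun a b hab => hg (congrArg Prod.fst hab)]; simp
    · intro i hi
      obtain ⟨h1, h2, h3⟩ := (hN i).1 hi
      refine toReal_sum_le _ D (fun j hj => (hW j (Finset.mem_filter.1 hj).1).2.1) fun g => ?_
      obtain ⟨a1, a2, -⟩ := hf i.2 h2 i.1 h1 h3
      obtain ⟨v, hvS, hv⟩ := (hV.atm_iff _).1 a1
      have hvF : v ∈ i.2.1 := by
        rw [← hV.pt_le hvS, ← hv]; exact a2.trans h3
      let o : Faces P × Faces P → EucSp 4 := fun j => if s j.1 = v then t j.1 else s j.1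
      refine lem2 hV i.2 h2.1 hvF _ N1 N2 o g fun j hj => ?_
      obtain ⟨hj, hjg⟩ := Finset.mem_filter.1 hj
      obtain ⟨hjN, hji⟩ := Finset.mem_filter.1 hj
      obtain ⟨j1, j2, j3⟩ := (hN j).1 hjN
      have e1 : j.2 = i.2 := congrArg Prod.fst hji
      have e2 : f j.2 j.1 = f i.2 i.1 := congrArg Prod.snd hji
      obtain ⟨b1, b2, -⟩ := hf j.2 j2 j.1 j1 j3
      obtain ⟨hw, -, -, hD⟩ := hW j hjN
      rw [e2, hv, hV.pt_le] at b2
      rw [e1] at hw j3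
      obtain ⟨q1, q2, q3, q4⟩ := hst j.1 j1
      refine ⟨e1, j3, ?_, ?_, ?_, hvS, ?_, hD g hjg⟩
      · simp only [o]; split_ifs <;> assumption
      · simp only [o]; split_ifs with h
        · rw [← h]; exact q3
        · exact fun h' => h h'.symm
      · intro u hu
        rw [q4 u hu]
        simp only [o]
        rcases (q4 v hvS).1 b2 with h | h
        · rw [if_pos h.symm, h]
        · rw [if_neg (by rw [h]; exact q3), h, or_comm]
      · simp only [o]
        rcases (q4 v hvS).1 b2 with h | h
        · rw [if_pos h.symm, h]; exact hw
        · rw [if_neg (by rw [h]; exact q3), h]; exact hw.symm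
  obtain ⟨e, F, h1, h2, h3⟩ := hex
  have hpos : 0 < N.card := Finset.card_pos.2 ⟨(e, F), (hN _).2 ⟨h1, h2, h3⟩⟩
  have hpos' : (0 : ℝ) < N.card := by exact_mod_cast hpos
  have := mul_pos hpos' hm
  push_cast at hc hd
  linarith

/-! ## Exact arithmetic in the ring of golden integers -/

/-- The pair `(a, b)` stands for `a + b φ`. -/
abbrev ZZ := ℤ × ℤ

/-- Vectors with golden-integer coordinates. -/
abbrev ZV := ZZ × ZZ × ZZ

namespace Gold

/-- Product of golden integers. -/
def mul (x y : ZZ) : ZZ := (x.1 * y.1 + x.2 * y.2, x.1 * y.2 + x.2 * y.1 + x.2 * y.2)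

/-- Sum of golden integers. -/
def add (x y : ZZ) : ZZ := (x.1 + y.1, x.2 + y.2)

/-- Difference of golden integers. -/
def sub (x y : ZZ) : ZZ := (x.1 - y.1, x.2 - y.2)

/-- Scalar product. -/
def dot (u v : ZV) : ZZ := add (mul u.1 v.1) (add (mul u.2.1 v.2.1) (mul u.2.2 v.2.2))

/-- Sum of vectors. -/
def vadd (u v : ZV) : ZV := (add u.1 v.1, add u.2.1 v.2.1, add u.2.2 v.2.2)

/-- Difference of vectors. -/
def vsub (u v : ZV) : ZV := (sub u.1 v.1, sub u.2.1 v.2.1, sub u.2.2 v.2.2)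

/-- Multiple of a vector. -/
def vsmul (z : ZZ) (v : ZV) : ZV := (mul z v.1, mul z v.2.1, mul z v.2.2)

/-- Cross product. -/
def cross (u v : ZV) : ZV :=
  (sub (mul u.2.1 v.2.2) (mul u.2.2 v.2.1), sub (mul u.2.2 v.1) (mul u.1 v.2.2),
    sub (mul u.1 v.2.1) (mul u.2.1 v.1))

/-- A sufficient condition for positivity. -/
def pos (z : ZZ) : Bool := decide (0 < 1000 * z.1 + 1618 * z.2) && decide (0 < 10000 * z.1 + 16181 * z.2)

def listN : List ZV := [
  ((0, 0), (0, 0), (0, 2)), ((0, 2), (0, 0), (0, 0)), ((0, 0), (0, 2), (0, 0)),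
  ((0, 0), (0, 0), (0, -2)), ((0, -2), (0, 0), (0, 0)), ((0, 0), (0, -2), (0, 0)),
  ((1, 0), (0, 1), (1, 1)), ((1, 1), (1, 0), (0, 1)), ((0, 1), (1, 1), (1, 0)),
  ((1, 0), (0, 1), (-1, -1)), ((-1, -1), (1, 0), (0, 1)), ((0, 1), (-1, -1), (1, 0)),
  ((1, 0), (0, -1), (1, 1)), ((1, 1), (1, 0), (0, -1)), ((0, -1), (1, 1), (1, 0)),
  ((1, 0), (0, -1), (-1, -1)), ((-1, -1), (1, 0), (0, -1)), ((0, -1), (-1, -1), (1, 0)),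
  ((-1, 0), (0, 1), (1, 1)), ((1, 1), (-1, 0), (0, 1)), ((0, 1), (1, 1), (-1, 0)),
  ((-1, 0), (0, 1), (-1, -1)), ((-1, -1), (-1, 0), (0, 1)), ((0, 1), (-1, -1), (-1, 0)),
  ((-1, 0), (0, -1), (1, 1)), ((1, 1), (-1, 0), (0, -1)), ((0, -1), (1, 1), (-1, 0)),
  ((-1, 0), (0, -1), (-1, -1)), ((-1, -1), (-1, 0), (0, -1)), ((0, -1), (-1, -1), (-1, 0))]

def listA : List ZV := [
  ((1, 0), (0, 0), (0, 1)), ((0, 1), (1, 0), (0, 0)), ((0, 0), (0, 1), (1, 0)),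
  ((1, 0), (0, 0), (0, -1)), ((0, -1), (1, 0), (0, 0)), ((0, 0), (0, -1), (1, 0)),
  ((-1, 0), (0, 0), (0, 1)), ((0, 1), (-1, 0), (0, 0)), ((0, 0), (0, 1), (-1, 0)),
  ((-1, 0), (0, 0), (0, -1)), ((0, -1), (-1, 0), (0, 0)), ((0, 0), (0, -1), (-1, 0))]

def listB : List ZV := [
  ((1, 0), (1, 0), (1, 0)), ((1, 0), (1, 0), (-1, 0)), ((1, 0), (-1, 0), (1, 0)),
  ((1, 0), (-1, 0), (-1, 0)), ((-1, 0), (1, 0), (1, 0)), ((-1, 0), (1, 0), (-1, 0)),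
  ((-1, 0), (-1, 0), (1, 0)), ((-1, 0), (-1, 0), (-1, 0)), ((0, 0), (-1, 1), (0, 1)),
  ((0, 1), (0, 0), (-1, 1)), ((-1, 1), (0, 1), (0, 0)), ((0, 0), (-1, 1), (0, -1)),
  ((0, -1), (0, 0), (-1, 1)), ((-1, 1), (0, -1), (0, 0)), ((0, 0), (1, -1), (0, 1)),
  ((0, 1), (0, 0), (1, -1)), ((1, -1), (0, 1), (0, 0)), ((0, 0), (1, -1), (0, -1)),
  ((0, -1), (0, 0), (1, -1)), ((1, -1), (0, -1), (0, 0))]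

/-- All 32 vertices of the rhombic triacontahedron (up to scaling). -/
def listQ : List ZV := listA ++ listB

/-- The normalization constant `2 φ²`. -/
def T : ZZ := (2, 2)

/-- The vertices of the face with normal `n`. -/
def around (n : ZV) : List ZV := listQ.filter fun q => decide (dot n q = T)

/-- The normals of faces containing the vertex `q`. -/
def aroundQ (q : ZV) : List ZV := listN.filter fun n => decide (dot n q = T)

/-- The neighbours of a vertex in `listA`. -/
def nbrs (p : ZV) : List ZV := listB.filter fun c => decide (dot p c = (1, 1))

lemma tab_le : ∀ n ∈ listN, ∀ q ∈ listQ, dot n q = T ∨ pos (sub T (dot n q)) = true := by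
  decide +kernel

lemma tab_strictN : ∀ u ∈ listN, ∀ v ∈ listN, u = v ∨ pos (sub (dot u u) (dot u v)) = true := by
  decide +kernel

lemma tab_strictQ : ∀ u ∈ listQ, ∀ v ∈ listQ, u = v ∨ pos (sub (dot u u) (dot u v)) = true := by
  decide +kernel

lemma tab_neg : ∀ q ∈ listQ, vsub ((0, 0), (0, 0), (0, 0)) q ∈ listQ := by
  decide +kernel

lemma tab_span : ∀ q ∈ listQ, ∃ a ∈ aroundQ q, ∃ b ∈ aroundQ q, ∃ c ∈ aroundQ q,
    pos (dot a (cross b c)) = true := by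
  decide +kernel

lemma tab_four : ∀ n ∈ listN, (around n).length = 4 := by
  decide +kernel

lemma nodupQ : listQ.Nodup := by
  decide +kernel

lemma tab_sep : ∀ q ∈ listQ, ∀ r ∈ listQ, q = r ∨ ∃ n ∈ aroundQ q, pos (sub T (dot n r)) = true := by
  decide +kernel

/-- There is a face containing `a` and `b` but not `c`. -/
def Nb (a b c : ZV) : Prop := ∃ m ∈ aroundQ a, dot m b = T ∧ pos (sub T (dot m c)) = true

instance (a b c : ZV) : Decidable (Nb a b c) := by unfold Nb; infer_instance

lemma tab_rhomb : ∀ n ∈ listN, ∃ p ∈ around n, ∃ c ∈ around n, ∃ d ∈ around n, ∃ r ∈ around n,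
    vadd p r = vadd c d ∧ pos (dot p (cross c d)) = true ∧
      Nb p d c ∧ Nb p c d ∧ Nb r d c ∧ Nb r c d := by
  decide +kernel

/-- Membership in `listQ`, after a cheap test. -/
def memQ (m : ZV) : Bool :=
  (decide (dot m m = (2, 1)) || decide (dot m m = (3, 0))) && decide (m ∈ listQ)

/-- `k` is a third vertex on any face containing `i` and `j`. -/
def third (i j k : ZV) : Bool :=
  (memQ (vsub (vadd i j) k) || memQ (vsmul (0, 1) (vsub (vadd i j) k))) &&
    !decide (k = i) && !decide (k = j)

/-- No edge joins `i` and `j`: any face containing both contains a third vertex. -/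
def NoEdge (i j : ZV) : Prop := ∃ k ∈ listQ, third i j k = true

instance (i j : ZV) : Decidable (NoEdge i j) := by unfold NoEdge; infer_instance

lemma tab_noEdgeA : ∀ i ∈ listA, ∀ j ∈ listA, i = j ∨ NoEdge i j := by
  decide +kernel

lemma tab_noEdgeB : ∀ i ∈ listB, ∀ j ∈ listB, i = j ∨ NoEdge i j := by
  decide +kernel

lemma tab_five : ∀ p ∈ listA, (nbrs p).length = 5 := by
  decide +kernel

/-- The functional exposing the edge from `p` to `c`. -/
def edgeF (p c : ZV) : ZV := vadd p (vsmul (1, 1) c)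

lemma tab_edge : ∀ p ∈ listA, ∀ c ∈ nbrs p, dot (edgeF p c) p = dot (edgeF p c) c ∧
    ∀ q ∈ listQ, q = p ∨ q = c ∨ pos (sub (dot (edgeF p c) p) (dot (edgeF p c) q)) = true := by
  decide +kernel

lemma tab_disj : ∀ p ∈ listA, p ∉ listB := by
  decide +kernel

/-- The two signs. -/
def sg : List ℤ := [1, -1]

lemma listN_eq : listN =
    (sg.flatMap fun e => [((0, 0), (0, 0), (0, 2 * e)), ((0, 2 * e), (0, 0), (0, 0)),
      ((0, 0), (0, 2 * e), (0, 0))]) ++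
    sg.flatMap fun a => sg.flatMap fun b => sg.flatMap fun c =>
      [((a, 0), (0, b), (c, c)), ((c, c), (a, 0), (0, b)), ((0, b), (c, c), (a, 0))] := by
  decide +kernel

/-! ### Real values -/

lemma phi_sq : goldenφ ^ 2 = goldenφ + 1 := by
  unfold goldenφ
  have := Real.sq_sqrt (show (0 : ℝ) ≤ 5 by norm_num)
  nlinarith

lemma phi_lb : (1.618 : ℝ) < goldenφ := by
  unfold goldenφ
  have : (2.236 : ℝ) < √5 := Real.lt_sqrt_of_sq_lt (by norm_num)
  linarith

lemma phi_ub : goldenφ < (1.6181 : ℝ) := by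
  unfold goldenφ
  have : √5 < (2.2362 : ℝ) := (Real.sqrt_lt' (by norm_num)).2 (by norm_num)
  linarith

/-- Value of a golden integer. -/
noncomputable def val (z : ZZ) : ℝ := z.1 + z.2 * goldenφ

/-- Real vector. -/
noncomputable def vec (v : ZV) : EucSp 3 := pt3 (val v.1) (val v.2.1) (val v.2.2)

lemma val_add (x y : ZZ) : val (add x y) = val x + val y := by
  simp only [val, add]; push_cast; ring

lemma val_sub (x y : ZZ) : val (sub x y) = val x - val y := by
  simp only [val, sub]; push_cast; ring

lemma val_mul (x y : ZZ) : val (mul x y) = val x * val y := by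
  simp only [val, mul]; push_cast; linear_combination (-(x.2 : ℝ) * y.2) * phi_sq

lemma val_T : val T = 2 * goldenφ ^ 2 := by
  rw [phi_sq]; simp only [val, T]; push_cast; ring

lemma val_pos {z : ZZ} (h : pos z = true) : 0 < val z := by
  simp only [pos, Bool.and_eq_true, decide_eq_true_eq] at h
  obtain ⟨h1, h2⟩ := h
  have h1' : (0 : ℝ) < 1000 * z.1 + 1618 * z.2 := by exact_mod_cast h1
  have h2' : (0 : ℝ) < 10000 * z.1 + 16181 * z.2 := by exact_mod_cast h2
  have l := phi_lb
  have u := phi_ub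
  simp only [val]
  rcases le_total 0 (z.2 : ℝ) with h | h
  · nlinarith
  · nlinarith

lemma inner_pt3 (a b c x y z : ℝ) : ⟪pt3 a b c, pt3 x y z⟫ = a * x + b * y + c * z := by
  simp [pt3, PiLp.inner_apply, Fin.sum_univ_three]
  ring

lemma inner_vec (u v : ZV) : ⟪vec u, vec v⟫ = val (dot u v) := by
  simp only [vec, dot, inner_pt3, val_add, val_mul]; ring

lemma pt3_ext (x : EucSp 3) : x = pt3 (x 0) (x 1) (x 2) := by
  ext i; fin_cases i <;> simp [pt3]

lemma pt3_add (a b c x y z : ℝ) : pt3 a b c + pt3 x y z = pt3 (a + x) (b + y) (c + z) := by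
  ext i; fin_cases i <;> simp [pt3]

lemma pt3_sub (a b c x y z : ℝ) : pt3 a b c - pt3 x y z = pt3 (a - x) (b - y) (c - z) := by
  ext i; fin_cases i <;> simp [pt3]

lemma pt3_smul (r x y z : ℝ) : r • pt3 x y z = pt3 (r * x) (r * y) (r * z) := by
  ext i; fin_cases i <;> simp [pt3]

lemma vec_add (u v : ZV) : vec (vadd u v) = vec u + vec v := by
  simp only [vec, vadd, val_add, pt3_add]

lemma vec_sub (u v : ZV) : vec (vsub u v) = vec u - vec v := by
  simp only [vec, vsub, val_sub, pt3_sub]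

lemma vec_smul (z : ZZ) (v : ZV) : vec (vsmul z v) = val z • vec v := by
  simp only [vec, vsmul, val_mul, pt3_smul]

lemma vec_zero : vec ((0, 0), (0, 0), (0, 0)) = 0 := by
  ext i; fin_cases i <;> simp [vec, pt3, val]

/-- Cramer's rule. -/
lemma cramer (a b c : ZV) (y : EucSp 3) : val (dot a (cross b c)) • y =
    ⟪vec (cross b c), y⟫ • vec a + ⟪vec (cross c a), y⟫ • vec b +
      ⟪vec (cross a b), y⟫ • vec c := by
  rw [pt3_ext y]
  simp only [vec, cross, dot, inner_pt3, pt3_smul, pt3_add, val_add, val_sub, val_mul]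
  congr 1 <;> ring

/-- Dual form of Cramer's rule. -/
lemma eq_zero_of_three {a b c : ZV} (h : pos (dot a (cross b c)) = true) {L : EucSp 3}
    (ha : ⟪L, vec a⟫ = 0) (hb : ⟪L, vec b⟫ = 0) (hc : ⟪L, vec c⟫ = 0) : L = 0 := by
  have h1 := congrArg (fun z => ⟪L, z⟫) (cramer a b c L)
  simp only [inner_add_right, inner_smul_right, ha, hb, hc, mul_zero, add_zero] at h1
  have h2 := val_pos h
  exact inner_self_eq_zero.1 ((mul_eq_zero.1 h1).resolve_left h2.ne')

end Gold

namespace Gold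

/-! ## The icosidodecahedron -/

lemma mem_listN (n : ZV) : n ∈ listN ↔
    (∃ e : ℤ, (e = 1 ∨ e = -1) ∧ (n = ((0, 0), (0, 0), (0, 2 * e)) ∨
      n = ((0, 2 * e), (0, 0), (0, 0)) ∨ n = ((0, 0), (0, 2 * e), (0, 0)))) ∨
    (∃ a b c : ℤ, (a = 1 ∨ a = -1) ∧ (b = 1 ∨ b = -1) ∧ (c = 1 ∨ c = -1) ∧
      (n = ((a, 0), (0, b), (c, c)) ∨ n = ((c, c), (a, 0), (0, b)) ∨
        n = ((0, b), (c, c), (a, 0)))) := by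
  rw [listN_eq]
  simp only [List.mem_append, List.mem_flatMap, sg, List.mem_cons, List.not_mem_nil, or_false]
  refine or_congr Iff.rfl ⟨?_, ?_⟩
  · rintro ⟨a, ha, b, hb, c, hc, h⟩
    exact ⟨a, b, c, ha, hb, hc, h⟩
  · rintro ⟨a, b, c, ha, hb, hc, h⟩
    exact ⟨a, ha, b, hb, c, hc, h⟩

lemma sign_cast {x : ℝ} (h : x = 1 ∨ x = -1) : ∃ e : ℤ, (e = 1 ∨ e = -1) ∧ x = e := by
  rcases h with rfl | rfl
  · exact ⟨1, Or.inl rfl, by norm_num⟩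
  · exact ⟨-1, Or.inr rfl, by norm_num⟩

lemma cast_sign {e : ℤ} (h : e = 1 ∨ e = -1) : (e : ℝ) = 1 ∨ (e : ℝ) = -1 := by
  rcases h with rfl | rfl <;> norm_num

/-- Vertex of the icosidodecahedron. -/
noncomputable def pI (n : ZV) : EucSp 3 := (1 / 2 : ℝ) • vec n

lemma pI1 (e : ℤ) : pI ((0, 0), (0, 0), (0, 2 * e)) = pt3 0 0 (e * goldenφ) := by
  simp only [pI, vec, pt3_smul, val]; push_cast; congr 1 <;> ring

lemma pI2 (e : ℤ) : pI ((0, 2 * e), (0, 0), (0, 0)) = pt3 (e * goldenφ) 0 0 := by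
  simp only [pI, vec, pt3_smul, val]; push_cast; congr 1 <;> ring

lemma pI3 (e : ℤ) : pI ((0, 0), (0, 2 * e), (0, 0)) = pt3 0 (e * goldenφ) 0 := by
  simp only [pI, vec, pt3_smul, val]; push_cast; congr 1 <;> ring

lemma pI4 (a b c : ℤ) : pI ((a, 0), (0, b), (c, c)) =
    pt3 (a / 2) (b * goldenφ / 2) (c * goldenφ ^ 2 / 2) := by
  simp only [pI, vec, pt3_smul, val, phi_sq]; push_cast; congr 1 <;> ring

lemma pI5 (a b c : ℤ) : pI ((c, c), (a, 0), (0, b)) =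
    pt3 (c * goldenφ ^ 2 / 2) (a / 2) (b * goldenφ / 2) := by
  simp only [pI, vec, pt3_smul, val, phi_sq]; push_cast; congr 1 <;> ring

lemma pI6 (a b c : ℤ) : pI ((0, b), (c, c), (a, 0)) =
    pt3 (b * goldenφ / 2) (c * goldenφ ^ 2 / 2) (a / 2) := by
  simp only [pI, vec, pt3_smul, val, phi_sq]; push_cast; congr 1 <;> ring

/-- The vertex set of the icosidodecahedron. -/
def SI : Set (EucSp 3) := {x | ∃ n ∈ listN, x = pI n}

lemma verts_eq : icosidodecaVerts = SI := by
  ext x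
  constructor
  · rintro (⟨e, he, h⟩ | ⟨a, b, c, ha, hb, hc, h⟩)
    · obtain ⟨e, he', rfl⟩ := sign_cast he
      clear he
      rename' he' => he
      rcases h with h | h | h
      · exact ⟨_, (mem_listN _).2 (Or.inl ⟨e, he, Or.inl rfl⟩), by rw [pI1, h]⟩
      · exact ⟨_, (mem_listN _).2 (Or.inl ⟨e, he, Or.inr (Or.inl rfl)⟩), by rw [pI2, h]⟩
      · exact ⟨_, (mem_listN _).2 (Or.inl ⟨e, he, Or.inr (Or.inr rfl)⟩), by rw [pI3, h]⟩
    · obtain ⟨a, ha', rfl⟩ := sign_cast ha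
      clear ha
      rename' ha' => ha
      obtain ⟨b, hb', rfl⟩ := sign_cast hb
      clear hb
      rename' hb' => hb
      obtain ⟨c, hc', rfl⟩ := sign_cast hc
      clear hc
      rename' hc' => hc
      rcases h with h | h | h
      · exact ⟨_, (mem_listN _).2 (Or.inr ⟨a, b, c, ha, hb, hc, Or.inl rfl⟩), by rw [pI4, h]⟩
      · exact ⟨_, (mem_listN _).2 (Or.inr ⟨a, b, c, ha, hb, hc, Or.inr (Or.inl rfl)⟩),
          by rw [pI5, h]⟩
      · exact ⟨_, (mem_listN _).2 (Or.inr ⟨a, b, c, ha, hb, hc, Or.inr (Or.inr rfl)⟩),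
          by rw [pI6, h]⟩
  · rintro ⟨n, hn, rfl⟩
    rcases (mem_listN n).1 hn with ⟨e, he, h⟩ | ⟨a, b, c, ha, hb, hc, h⟩
    · refine Or.inl ⟨e, cast_sign he, ?_⟩
      rcases h with rfl | rfl | rfl
      · exact Or.inl (pI1 e)
      · exact Or.inr (Or.inl (pI2 e))
      · exact Or.inr (Or.inr (pI3 e))
    · refine Or.inr ⟨a, b, c, cast_sign ha, cast_sign hb, cast_sign hc, ?_⟩
      rcases h with rfl | rfl | rfl
      · exact Or.inl (pI4 a b c)
      · exact Or.inr (Or.inl (pI5 a b c))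
      · exact Or.inr (Or.inr (pI6 a b c))

lemma vertI : Vert SI Icosidodecahedron := by
  have hull : Icosidodecahedron = convexHull ℝ SI := by
    unfold Icosidodecahedron; rw [verts_eq]
  refine ⟨hull, ?_⟩
  rintro s ⟨n, hn, rfl⟩
  refine exposed_of_strict (L := vec n) hull ⟨n, hn, rfl⟩ ?_
  rintro t ⟨m, hm, rfl⟩ hne
  rcases tab_strictN n hn m hm with rfl | h
  · exact absurd rfl hne
  · have := val_pos h
    rw [val_sub] at this
    simp only [pI, inner_smul_right, inner_vec]
    linarith

lemma inner_pI (q n : ZV) : ⟪vec q, pI n⟫ = val (dot n q) / 2 := by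
  rw [pI, inner_smul_right, real_inner_comm, inner_vec]; ring

lemma phi_pos : 0 < goldenφ := by linarith [phi_lb]

lemma facet_le (q : ZV) (hq : q ∈ listQ) : ∀ x ∈ Icosidodecahedron,
    ⟪vec q, x⟫ ≤ goldenφ ^ 2 := by
  refine vertI.le_of ?_
  rintro s ⟨n, hn, rfl⟩
  rw [inner_pI]
  rcases tab_le n hn q hq with h | h
  · rw [h, val_T]; linarith
  · have := val_pos h
    rw [val_sub, val_T] at this
    linarith

/-- The facet of the icosidodecahedron with normal `q`. -/
noncomputable def facetI (q : ZV) (hq : q ∈ listQ) : Faces Icosidodecahedron :=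
  mkFace (vec q) (goldenφ ^ 2) (facet_le q hq)

lemma mem_facetI {q : ZV} (hq : q ∈ listQ) {n : ZV} (hn : n ∈ listN) :
    pI n ∈ (facetI q hq).1 ↔ val (dot n q) = val T := by
  unfold facetI
  rw [mem_mkFace, inner_pI, val_T]
  constructor
  · rintro ⟨_, h⟩; linarith
  · intro h; exact ⟨vertI.sub ⟨n, hn, rfl⟩, by linarith⟩

lemma mem_around {n q : ZV} : q ∈ around n ↔ q ∈ listQ ∧ dot n q = T := by
  simp [around]

lemma mem_aroundQ {n q : ZV} : n ∈ aroundQ q ↔ n ∈ listN ∧ dot n q = T := by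
  simp [aroundQ]

lemma facetI_not (q : ZV) (hq : q ∈ listQ) : ∃ n ∈ listN, pI n ∉ (facetI q hq).1 := by
  have h1 : ∃ r ∈ listQ, r ≠ q := by
    by_contra hcon
    push Not at hcon
    have h2 := hcon ((1, 0), (0, 0), (0, 1)) (by decide +kernel)
    have h3 := hcon ((0, 1), (1, 0), (0, 0)) (by decide +kernel)
    rw [← h2] at h3
    exact absurd h3 (by decide +kernel)
  obtain ⟨r, hr, hne⟩ := h1
  obtain ⟨n, hn, hp⟩ := (tab_sep r hr q hq).resolve_left hne
  have hn' := (mem_aroundQ.1 hn).1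
  refine ⟨n, hn', fun hmem => ?_⟩
  rw [mem_facetI hq hn'] at hmem
  have := val_pos hp
  rw [val_sub] at this
  linarith

lemma coatm_facetI (q : ZV) (hq : q ∈ listQ) : Coatm (facetI q hq) := by
  refine ⟨fun hm => ?_, fun G hG => ?_⟩
  · obtain ⟨n, hn, hnot⟩ := facetI_not q hq
    rw [isMax_face] at hm
    rw [hm] at hnot
    exact hnot (vertI.sub ⟨n, hn, rfl⟩)
  · obtain ⟨a, ha, b, hb, c, hc, hdet⟩ := tab_span q hq
    have key : ∀ n ∈ aroundQ q, pI n ∈ (facetI q hq).1 := fun n hn => by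
      rw [mem_facetI hq (mem_aroundQ.1 hn).1, (mem_aroundQ.1 hn).2]
    have hGne : G.1.Nonempty := ⟨pI a, hG.le (key a ha)⟩
    obtain ⟨L, M, hLM, hGL⟩ := face_form G hGne
    have hex : ∃ s ∈ SI, s ∈ G.1 ∧ s ∉ (facetI q hq).1 := by
      by_contra hcon
      push Not at hcon
      exact hG.not_ge (vertI.le_iff.2 hcon)
    obtain ⟨s, ⟨m, hm, rfl⟩, hsG, hsF⟩ := hex
    have hp2 : (0 : ℝ) < goldenφ ^ 2 := by have := phi_pos; positivity
    have hval : ∀ n ∈ aroundQ q, ⟪L - (M / goldenφ ^ 2) • vec q, vec n⟫ = 0 := by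
      intro n hn
      have h1 : pI n ∈ G.1 := hG.le (key n hn)
      rw [hGL] at h1
      have h2 := h1.2
      rw [pI, inner_smul_right] at h2
      rw [inner_sub_left, inner_smul_left, real_inner_comm, inner_vec] 
      rw [real_inner_comm] at h2
      rw [show dot q n = T by rw [← (mem_aroundQ.1 hn).2]; simp only [dot, mul, add]; ext <;> simp <;> ring, val_T]
      simp only [conj_trivial]
      have : M / goldenφ ^ 2 * (2 * goldenφ ^ 2) = 2 * M := by
        rw [div_mul_eq_mul_div, div_eq_iff hp2.ne']; ring
      linarith
    have hL := eq_zero_of_three hdet (hval a ha) (hval b hb) (hval c hc)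
    rw [sub_eq_zero] at hL
    have h1 : ⟪L, pI m⟫ = M := by rw [hGL] at hsG; exact hsG.2
    have h2 : ⟪vec q, pI m⟫ ≠ goldenφ ^ 2 := by
      intro h
      exact hsF (mem_mkFace.2 ⟨vertI.sub ⟨m, hm, rfl⟩, h⟩)
    have hM : M = 0 := by
      by_contra hM
      apply h2
      rw [hL, inner_smul_left] at h1
      simp only [conj_trivial] at h1
      rw [div_mul_eq_mul_div, div_eq_iff hp2.ne'] at h1
      exact mul_left_cancel₀ hM h1
    rw [isMax_face, hGL]
    ext x
    simp [hL, hM]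

lemma facetI_inj {q r : ZV} (hq : q ∈ listQ) (hr : r ∈ listQ) (h : facetI q hq = facetI r hr) :
    q = r := by
  rcases tab_sep q hq r hr with h' | ⟨n, hn, hp⟩
  · exact h'
  · exfalso
    have hn' := mem_aroundQ.1 hn
    have h1 : pI n ∈ (facetI q hq).1 := by rw [mem_facetI hq hn'.1, hn'.2]
    rw [h, mem_facetI hr hn'.1] at h1
    have := val_pos hp
    rw [val_sub] at this
    linarith

/-- Every vertex of the icosidodecahedron is in (at least) four facets. -/
theorem claimI (x : Faces Icosidodecahedron) (hx : Atm x) :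
    ∃ g : Fin 4 → Faces Icosidodecahedron, Function.Injective g ∧
      ∀ i, Coatm (g i) ∧ x ≤ g i := by
  obtain ⟨s, ⟨n, hn, rfl⟩, rfl⟩ := (vertI.atm_iff x).1 hx
  have hlen := tab_four n hn
  have hnd : (around n).Nodup := nodupQ.filter _
  have hget : ∀ i : Fin 4, (around n).get (i.cast hlen.symm) ∈ around n := fun i =>
    List.get_mem _ _
  refine ⟨fun i => facetI _ (mem_around.1 (hget i)).1, ?_, ?_⟩
  · intro i j hij
    have := facetI_inj _ _ hij
    have := (List.nodup_iff_injective_get.1 hnd) this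
    exact Fin.cast_injective _ this
  · intro i
    refine ⟨coatm_facetI _ _, ?_⟩
    refine (vertI.pt_le _ _).2 ((mem_facetI _ hn).2 ?_)
    rw [(mem_around.1 (hget i)).2]

lemma exists_atmI : ∃ x : Faces Icosidodecahedron, Atm x :=
  ⟨vertI.pt ⟨((0, 0), (0, 0), (0, 2)), by decide +kernel, rfl⟩, vertI.atm_pt _⟩

end Gold

namespace Gold

/-! ## The rhombic triacontahedron -/

/-- Vertex of the rhombic triacontahedron. -/
noncomputable def pR (q : ZV) : EucSp 3 := (1 / goldenφ ^ 2) • vec q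

/-- The vertex set of the rhombic triacontahedron. -/
def SR : Set (EucSp 3) := {x | ∃ q ∈ listQ, x = pR q}

lemma phi2_pos : (0 : ℝ) < goldenφ ^ 2 := by have := phi_pos; positivity

lemma inner_pR (L : EucSp 3) (q : ZV) : ⟪L, pR q⟫ = ⟪L, vec q⟫ / goldenφ ^ 2 := by
  rw [pR, inner_smul_right]; ring

lemma vec_eq_pR (q : ZV) : vec q = goldenφ ^ 2 • pR q := by
  rw [pR, smul_smul, mul_one_div_cancel phi2_pos.ne', one_smul]

lemma mem_RT (y : EucSp 3) : y ∈ RhombicTriacontahedron ↔ ∀ n ∈ listN, ⟪vec n, y⟫ ≤ 2 := by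
  constructor
  · intro h n hn
    have h1 := h (pI n) (vertI.sub ⟨n, hn, rfl⟩)
    rw [pI, inner_smul_left] at h1
    simp only [conj_trivial] at h1
    linarith
  · intro h x hx
    rw [real_inner_comm]
    refine vertI.le_of (L := y) (M := 1) ?_ x hx
    rintro s ⟨n, hn, rfl⟩
    have h1 := h n hn
    rw [real_inner_comm, pI, inner_smul_left]
    simp only [conj_trivial]
    linarith

lemma conv_three {C : Set (EucSp 3)} (hC : Convex ℝ C) {x y z : EucSp 3} (h0 : 0 ∈ C) (hx : x ∈ C)
    (hy : y ∈ C) (hz : z ∈ C) {a b c : ℝ} (ha : 0 ≤ a) (hb : 0 ≤ b) (hc : 0 ≤ c)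
    (h : a + b + c ≤ 1) : a • x + b • y + c • z ∈ C := by
  have := hC.sum_mem (t := (Finset.univ : Finset (Fin 4))) (w := ![1 - (a + b + c), a, b, c])
    (z := ![0, x, y, z]) (by
      intro i _
      fin_cases i <;> simp <;> linarith) (by simp [Fin.sum_univ_four]; ring) (by
      intro i _
      fin_cases i <;> simp [*])
  simpa [Fin.sum_univ_four] using this

lemma neg_mem {q : ZV} (hq : q ∈ listQ) : ∃ r ∈ listQ, vec r = -vec q := by
  refine ⟨_, tab_neg q hq, ?_⟩
  rw [vec_sub, vec_zero, zero_sub]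

lemma a0_mem : (((1, 0), (0, 0), (0, 1)) : ZV) ∈ listA := by decide +kernel

lemma memA {q : ZV} (hq : q ∈ listA) : q ∈ listQ := List.mem_append.2 (Or.inl hq)

lemma memB {q : ZV} (hq : q ∈ listB) : q ∈ listQ := List.mem_append.2 (Or.inr hq)

lemma zero_mem_hull : (0 : EucSp 3) ∈ convexHull ℝ SR := by
  obtain ⟨r, hr, he⟩ := neg_mem (memA a0_mem)
  have h1 : pR _ ∈ convexHull ℝ SR := subset_convexHull _ _ ⟨_, memA a0_mem, rfl⟩
  have h2 : pR r ∈ convexHull ℝ SR := subset_convexHull _ _ ⟨r, hr, rfl⟩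
  have h3 := (convex_convexHull ℝ SR) h1 h2 (a := 1 / 2) (b := 1 / 2) (by norm_num) (by norm_num)
    (by norm_num)
  rw [pR, pR, he, smul_neg, smul_neg, add_neg_cancel] at h3
  exact h3

lemma le_of_tab {n q : ZV} (hn : n ∈ listN) (hq : q ∈ listQ) : val (dot n q) ≤ val T := by
  rcases tab_le n hn q hq with h | h
  · rw [h]
  · have := val_pos h
    rw [val_sub] at this
    linarith

lemma hull_weights {x y z : ZV} (hx : x ∈ listQ) (hy : y ∈ listQ) (hz : z ∈ listQ) {a b c : ℝ}
    (ha : 0 ≤ a) (hb : 0 ≤ b) (hc : 0 ≤ c) (h : val T * (a + b + c) ≤ 2) :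
    a • vec x + b • vec y + c • vec z ∈ convexHull ℝ SR := by
  rw [vec_eq_pR x, vec_eq_pR y, vec_eq_pR z, smul_smul, smul_smul, smul_smul]
  have hp := phi2_pos
  rw [val_T] at h
  exact conv_three (convex_convexHull ℝ SR) zero_mem_hull
    (subset_convexHull _ _ ⟨x, hx, rfl⟩) (subset_convexHull _ _ ⟨y, hy, rfl⟩)
    (subset_convexHull _ _ ⟨z, hz, rfl⟩) (by positivity) (by positivity) (by positivity)
    (by linarith)

lemma RT_sub : RhombicTriacontahedron ⊆ convexHull ℝ SR := by
  intro y hy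
  rw [mem_RT] at hy
  obtain ⟨n, hn, hmax⟩ := listN.toFinset.exists_max_image (fun n => ⟪vec n, y⟫)
    ⟨((0, 0), (0, 0), (0, 2)), by rw [List.mem_toFinset]; decide +kernel⟩
  rw [List.mem_toFinset] at hn
  have hmax' : ∀ m ∈ listN, ⟪vec m, y⟫ ≤ ⟪vec n, y⟫ := fun m hm =>
    hmax m (List.mem_toFinset.2 hm)
  obtain ⟨p, hp, c, hc, d, hd, r, hr, hsum, hdet, n1, n2, n3, n4⟩ := tab_rhomb n hn
  rw [mem_around] at hp hc hd hr
  have hD := val_pos hdet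
  obtain ⟨α, β, γ, hy'⟩ : ∃ α β γ : ℝ, y = α • vec p + β • vec c + γ • vec d := by
    have h1 := cramer p c d y
    refine ⟨⟪vec (cross c d), y⟫ / val (dot p (cross c d)),
      ⟪vec (cross d p), y⟫ / val (dot p (cross c d)),
      ⟪vec (cross p c), y⟫ / val (dot p (cross c d)), ?_⟩
    have h2 := congrArg (fun z => (val (dot p (cross c d)))⁻¹ • z) h1
    simp only [smul_add, smul_smul, inv_mul_cancel₀ hD.ne', one_smul] at h2
    simp only [div_eq_inv_mul]
    exact h2
  have hin : ∀ m, ⟪vec m, y⟫ = α * val (dot m p) + β * val (dot m c) + γ * val (dot m d) := by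
    intro m
    rw [hy']
    simp only [inner_add_right, inner_smul_right, inner_vec]
  have hpr : ∀ m, val (dot m p) + val (dot m r) = val (dot m c) + val (dot m d) := by
    intro m
    rw [← inner_vec, ← inner_vec, ← inner_vec, ← inner_vec, ← inner_add_right, ← inner_add_right,
      ← vec_add, ← vec_add, hsum]
  have hT : ⟪vec n, y⟫ = val T * (α + β + γ) := by
    rw [hin, hp.2, hc.2, hd.2]; ring
  have hβ : 0 ≤ β := by
    obtain ⟨m, hm, h1, h2⟩ := n1
    rw [mem_aroundQ] at hm
    have h3 := hmax' m hm.1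
    have h4 := val_pos h2
    rw [val_sub] at h4
    rw [hT, hin, hm.2, h1] at h3
    exact nonneg_of_mul_nonneg_right (show 0 ≤ (val T - val (dot m c)) * β by linarith) h4
  have hγ : 0 ≤ γ := by
    obtain ⟨m, hm, h1, h2⟩ := n2
    rw [mem_aroundQ] at hm
    have h3 := hmax' m hm.1
    have h4 := val_pos h2
    rw [val_sub] at h4
    rw [hT, hin, hm.2, h1] at h3
    exact nonneg_of_mul_nonneg_right (show 0 ≤ (val T - val (dot m d)) * γ by linarith) h4
  have hαβ : 0 ≤ α + β := by
    obtain ⟨m, hm, h1, h2⟩ := n3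
    rw [mem_aroundQ] at hm
    have h3 := hmax' m hm.1
    have h4 := val_pos h2
    have h5 := hpr m
    rw [val_sub] at h4
    rw [hm.2, h1] at h5
    have h6 : val (dot m p) = val (dot m c) := by linarith
    rw [hT, hin, h6, h1] at h3
    exact nonneg_of_mul_nonneg_right (show 0 ≤ (val T - val (dot m c)) * (α + β) by linarith) h4
  have hαγ : 0 ≤ α + γ := by
    obtain ⟨m, hm, h1, h2⟩ := n4
    rw [mem_aroundQ] at hm
    have h3 := hmax' m hm.1
    have h4 := val_pos h2
    have h5 := hpr m
    rw [val_sub] at h4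
    rw [hm.2, h1] at h5
    have h6 : val (dot m p) = val (dot m d) := by linarith
    rw [hT, hin, h6, h1] at h3
    exact nonneg_of_mul_nonneg_right (show 0 ≤ (val T - val (dot m d)) * (α + γ) by linarith) h4
  have h2 := hy n hn
  rw [hT] at h2
  rcases le_total 0 α with hα | hα
  · rw [hy']
    exact hull_weights hp.1 hc.1 hd.1 hα hβ hγ h2
  · have h3 : y = (-α) • vec r + (α + β) • vec c + (α + γ) • vec d := by
      have h4 : vec p = vec c + vec d - vec r := by
        rw [eq_sub_iff_add_eq, ← vec_add, ← vec_add, hsum]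
      rw [hy', h4]
      module
    rw [h3]
    refine hull_weights hr.1 hc.1 hd.1 (by linarith) hαβ hαγ ?_
    rw [show -α + (α + β) + (α + γ) = α + β + γ by ring]
    exact h2

lemma RT_hull : RhombicTriacontahedron = convexHull ℝ SR := by
  refine Set.Subset.antisymm RT_sub fun y hy => ?_
  rw [mem_RT]
  intro n hn
  refine inner_le_hull ?_ y hy
  rintro s ⟨q, hq, rfl⟩
  rw [inner_pR, inner_vec, div_le_iff₀ phi2_pos, ← val_T]
  exact le_of_tab hn hq

lemma vertR : Vert SR RhombicTriacontahedron := by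
  refine ⟨RT_hull, ?_⟩
  rintro s ⟨q, hq, rfl⟩
  refine exposed_of_strict (L := vec q) RT_hull ⟨q, hq, rfl⟩ ?_
  rintro t ⟨r, hr, rfl⟩ hne
  rcases tab_strictQ q hq r hr with rfl | h
  · exact absurd rfl hne
  · have := val_pos h
    rw [val_sub] at this
    simp only [inner_pR, inner_vec]
    have hp := phi2_pos
    gcongr
    linarith

lemma pR_inj {q r : ZV} (hq : q ∈ listQ) (hr : r ∈ listQ) (h : pR q = pR r) : q = r := by
  rcases tab_strictQ q hq r hr with h' | h'
  · exact h'
  · exfalso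
    have := val_pos h'
    rw [val_sub, ← inner_vec, ← inner_vec, vec_eq_pR r, ← h, ← vec_eq_pR] at this
    linarith

lemma mem_of_memQ {m : ZV} (h : memQ m = true) : m ∈ listQ := by
  simp only [memQ, Bool.and_eq_true, decide_eq_true_eq] at h
  exact h.2

lemma val_phi : val (0, 1) = goldenφ := by simp [val]

/-- A face containing two vertices of the same kind contains a third one. -/
lemma third_vertex {i j : ZV} (hi : i ∈ listQ) (hj : j ∈ listQ) (hij : NoEdge i j)
    (G : Faces RhombicTriacontahedron) (hiG : pR i ∈ G.1) (hjG : pR j ∈ G.1) :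
    ∃ k ∈ listQ, k ≠ i ∧ k ≠ j ∧ pR k ∈ G.1 := by
  obtain ⟨k, hk, hthird⟩ := hij
  simp only [third, Bool.and_eq_true, Bool.or_eq_true, Bool.not_eq_true',
    decide_eq_false_iff_not] at hthird
  obtain ⟨⟨hmem, hki⟩, hkj⟩ := hthird
  refine ⟨k, hk, hki, hkj, ?_⟩
  obtain ⟨L, M, hLM, hGL⟩ := face_form G ⟨_, hiG⟩
  have hp := phi2_pos
  have hle : ∀ q ∈ listQ, ⟪L, vec q⟫ ≤ M * goldenφ ^ 2 := by
    intro q hq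
    have := hLM _ (vertR.sub ⟨q, hq, rfl⟩)
    rwa [inner_pR, div_le_iff₀ hp] at this
  have heq : ∀ q, pR q ∈ G.1 → ⟪L, vec q⟫ = M * goldenφ ^ 2 := by
    intro q hq
    rw [hGL] at hq
    have := hq.2
    rwa [inner_pR, div_eq_iff hp.ne'] at this
  have hK : 0 ≤ M * goldenφ ^ 2 := by
    obtain ⟨r, hr, he⟩ := neg_mem hi
    have h1 := hle r hr
    have h2 := hle i hi
    rw [he, inner_neg_right] at h1
    linarith
  have hi' := heq i hiG
  have hj' := heq j hjG
  have hge : M * goldenφ ^ 2 ≤ ⟪L, vec k⟫ := by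
    rcases hmem with h | h
    · have h1 := hle _ (mem_of_memQ h)
      rw [vec_sub, vec_add, inner_sub_right, inner_add_right] at h1
      linarith
    · have h1 := hle _ (mem_of_memQ h)
      rw [vec_smul, inner_smul_right, vec_sub, vec_add, inner_sub_right, inner_add_right,
        val_phi, hi', hj'] at h1
      have h2 := phi_lb
      by_contra hlt
      push Not at hlt
      nlinarith
  rw [hGL]
  refine ⟨vertR.sub ⟨k, hk, rfl⟩, ?_⟩
  rw [inner_pR, div_eq_iff hp.ne']
  exact le_antisymm (hle k hk) hge

/-- An edge joins a vertex of degree five to a vertex of degree three. -/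
lemma edge_A (G : Faces RhombicTriacontahedron) (hG : Edg G) : ∃ p ∈ listA, pR p ∈ G.1 := by
  obtain ⟨s, t, ⟨i, hi, rfl⟩, ⟨j, hj, rfl⟩, hne, hh⟩ := (vertR.edg_iff G).1 hG
  have hiG : pR i ∈ G.1 := (hh _ ⟨i, hi, rfl⟩).2 (Or.inl rfl)
  have hjG : pR j ∈ G.1 := (hh _ ⟨j, hj, rfl⟩).2 (Or.inr rfl)
  rcases List.mem_append.1 hi with hiA | hiB
  · exact ⟨i, hiA, hiG⟩
  rcases List.mem_append.1 hj with hjA | hjB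
  · exact ⟨j, hjA, hjG⟩
  exfalso
  rcases tab_noEdgeB i hiB j hjB with h | h
  · exact hne (by rw [h])
  · obtain ⟨k, hk, hki, hkj, hkG⟩ := third_vertex hi hj h G hiG hjG
    rcases (hh _ ⟨k, hk, rfl⟩).1 hkG with h | h
    · exact hki (pR_inj hk hi h)
    · exact hkj (pR_inj hk hj h)

lemma mem_nbrs {p c : ZV} : c ∈ nbrs p ↔ c ∈ listB ∧ dot p c = (1, 1) := by
  simp [nbrs]

lemma edge_le {p c : ZV} (hp : p ∈ listA) (hc : c ∈ nbrs p) : ∀ x ∈ RhombicTriacontahedron,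
    ⟪vec (edgeF p c), x⟫ ≤ val (dot (edgeF p c) p) / goldenφ ^ 2 := by
  refine vertR.le_of ?_
  rintro s ⟨q, hq, rfl⟩
  rw [inner_pR, inner_vec]
  have hpp := phi2_pos
  obtain ⟨h1, h2⟩ := tab_edge p hp c hc
  gcongr
  rcases h2 q hq with rfl | rfl | h
  · exact le_rfl
  · rw [h1]
  · have := val_pos h
    rw [val_sub] at this
    linarith

/-- The edge from `p` to `c`. -/
noncomputable def edgeR {p c : ZV} (hp : p ∈ listA) (hc : c ∈ nbrs p) :
    Faces RhombicTriacontahedron :=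
  mkFace (vec (edgeF p c)) (val (dot (edgeF p c) p) / goldenφ ^ 2) (edge_le hp hc)

lemma mem_edgeR {p c : ZV} (hp : p ∈ listA) (hc : c ∈ nbrs p) {q : ZV} (hq : q ∈ listQ) :
    pR q ∈ (edgeR hp hc).1 ↔ (q = p ∨ q = c) := by
  obtain ⟨h1, h2⟩ := tab_edge p hp c hc
  have hpp := phi2_pos
  unfold edgeR
  rw [mem_mkFace, inner_pR, inner_vec, div_left_inj' hpp.ne']
  constructor
  · rintro ⟨_, h⟩
    rcases h2 q hq with h3 | h3 | h3
    · exact Or.inl h3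
    · exact Or.inr h3
    · have := val_pos h3
      rw [val_sub] at this
      linarith
  · rintro (rfl | rfl)
    · exact ⟨vertR.sub ⟨_, hq, rfl⟩, rfl⟩
    · exact ⟨vertR.sub ⟨_, hq, rfl⟩, by rw [h1]⟩

lemma ne_nbr {p c : ZV} (hp : p ∈ listA) (hc : c ∈ nbrs p) : p ≠ c := by
  rintro rfl
  exact tab_disj p hp (mem_nbrs.1 hc).1

lemma edg_edgeR {p c : ZV} (hp : p ∈ listA) (hc : c ∈ nbrs p) : Edg (edgeR hp hc) := by
  have hpQ := memA hp
  have hcQ := memB (mem_nbrs.1 hc).1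
  refine (vertR.edg_iff _).2 ⟨pR p, pR c, ⟨p, hpQ, rfl⟩, ⟨c, hcQ, rfl⟩,
    fun h => ne_nbr hp hc (pR_inj hpQ hcQ h), ?_⟩
  rintro u ⟨q, hq, rfl⟩
  rw [mem_edgeR hp hc hq]
  constructor
  · rintro (rfl | rfl)
    · exact Or.inl rfl
    · exact Or.inr rfl
  · rintro (h | h)
    · exact Or.inl (pR_inj hq hpQ h)
    · exact Or.inr (pR_inj hq hcQ h)

/-- The degree-five endpoint of an edge. -/
noncomputable def endA (x : Faces RhombicTriacontahedron) : Faces RhombicTriacontahedron :=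
  if h : ∃ p ∈ listA, pR p ∈ x.1 then
    vertR.pt (s := pR h.choose) ⟨h.choose, memA h.choose_spec.1, rfl⟩
  else x

theorem claimR (x : Faces RhombicTriacontahedron) (hx : Edg x) :
    Atm (endA x) ∧ endA x ≤ x ∧ ∃ g : Fin 5 → Faces RhombicTriacontahedron,
      Function.Injective g ∧ ∀ i, Edg (g i) ∧ endA (g i) = endA x := by
  have h := edge_A x hx
  obtain ⟨p, hpA, hpx, he⟩ : ∃ p, ∃ hp : p ∈ listA, pR p ∈ x.1 ∧
      endA x = vertR.pt (s := pR p) ⟨p, memA hp, rfl⟩ :=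
    ⟨h.choose, h.choose_spec.1, h.choose_spec.2, by rw [endA, dif_pos h]⟩
  rw [he]
  refine ⟨vertR.atm_pt _, (vertR.pt_le _ _).2 hpx, ?_⟩
  have hlen := tab_five p hpA
  have hnd : (nbrs p).Nodup := (List.Nodup.of_append_right nodupQ).filter _
  have hget : ∀ i : Fin 5, (nbrs p).get (i.cast hlen.symm) ∈ nbrs p := fun i =>
    List.get_mem _ _
  refine ⟨fun i => edgeR hpA (hget i), ?_, fun i => ⟨edg_edgeR hpA (hget i), ?_⟩⟩
  · intro i j hij
    have hij' : edgeR hpA (hget i) = edgeR hpA (hget j) := hij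
    have hQ := memB (mem_nbrs.1 (hget i)).1
    have h1 := (mem_edgeR hpA (hget i) hQ).2 (Or.inr rfl)
    rw [hij', mem_edgeR hpA (hget j) hQ] at h1
    rcases h1 with h1 | h1
    · exact absurd h1.symm (ne_nbr hpA (hget i))
    · exact Fin.cast_injective _ ((List.nodup_iff_injective_get.1 hnd) h1)
  · have h2 : ∃ p' ∈ listA, pR p' ∈ (edgeR hpA (hget i)).1 :=
      ⟨p, hpA, (mem_edgeR hpA (hget i) (memA hpA)).2 (Or.inl rfl)⟩
    have h3 : h2.choose = p := by
      have h4 := h2.choose_spec.2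
      rw [mem_edgeR hpA (hget i) (memA h2.choose_spec.1)] at h4
      rcases h4 with h4 | h4
      · exact h4
      · have h5 := h2.choose_spec.1
        rw [h4] at h5
        exact absurd (mem_nbrs.1 (hget i)).1 (tab_disj _ h5)
    show endA (edgeR hpA (hget i)) = _
    rw [endA, dif_pos h2]
    apply Subtype.ext
    show ({pR h2.choose} : Set (EucSp 3)) = {pR p}
    rw [h3]

lemma exists_edgR : ∃ x : Faces RhombicTriacontahedron, Edg x := by
  have h : (((1, 0), (1, 0), (1, 0)) : ZV) ∈ nbrs ((1, 0), (0, 0), (0, 1)) := by decide +kernel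
  exact ⟨_, edg_edgeR a0_mem h⟩

end Gold

lemma faceRank_pt {S P : Set (EucSp 4)} (hV : Vert S P) {s : EucSp 4} (hs : s ∈ S) :
    faceRank (hV.pt hs) = 0 := by
  have h1 : (hV.pt hs).1 = {s} := rfl
  rw [faceRank, h1, if_neg (Set.singleton_ne_empty s), direction_affineSpan, vectorSpan_singleton]
  simp

lemma faceRank_coatm {S P : Set (EucSp 4)} (hV : Vert S P) (hS : S.Finite)
    (hP : (interior P).Nonempty) (F : Faces P) (hF : Coatm F) (hne : F.1.Nonempty) :
    faceRank F = 3 := by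
  rw [faceRank, if_neg hne.ne_empty, finrank_coatm hV hS hP F hF hne]
  norm_num

/-- There is no convex 4-polytope all of whose facets are (combinatorially)
rhombic triacontahedra and all of whose vertex figures are (combinatorially)
icosidodecahedra. -/
theorem no_rhombic_triacontahedral_four_polytope :
    ¬ ∃ P : Set (EucSp 4), IsConvexPolytope P ∧
      (∀ F : Faces P, faceRank F = 3 →
        Nonempty ({G : Faces P // G ≤ F} ≃o Faces RhombicTriacontahedron)) ∧
      (∀ v : Faces P, faceRank v = 0 →
        Nonempty ({G : Faces P // v ≤ G} ≃o Faces Icosidodecahedron)) := by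
  rintro ⟨P, ⟨⟨T, hT⟩, hP⟩, hfac, hver⟩
  obtain ⟨S, hS, hV⟩ := exists_vert T hT
  -- every atom above a vertex lies in four facets
  have habove : ∀ (s : EucSp 4) (hs : s ∈ S) (x : {G : Faces P // hV.pt hs ≤ G}), Atm x →
      ∃ g : Fin 4 → Faces P, Function.Injective g ∧ ∀ i, Coatm (g i) ∧ x.1 ≤ g i := by
    intro s hs x hx
    obtain ⟨f⟩ := hver (hV.pt hs) (faceRank_pt hV hs)
    obtain ⟨g, hg, hg'⟩ := Gold.claimI (f x) ((atm_iso f x).2 hx)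
    refine ⟨fun i => (f.symm (g i)).1, fun i j hij => hg (f.symm.injective (Subtype.ext hij)),
      fun i => ⟨coatm_above _ ((coatm_iso f.symm _).2 (hg' i).1), ?_⟩⟩
    have h1 : x ≤ f.symm (g i) := f.le_symm_apply.2 (hg' i).2
    exact h1
  refine core hV hS hP ?_ ?_ ?_
  · intro e he
    obtain ⟨s, t, hs, ht, hne, hh⟩ := (hV.edg_iff e).1 he
    have hle : hV.pt hs ≤ e := (hV.pt_le hs e).2 ((hh s hs).2 (Or.inl rfl))
    exact habove s hs ⟨e, hle⟩ (hV.atm_above hs ht hne hh hle)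
  · intro F hF hne
    obtain ⟨f⟩ := hfac F (faceRank_coatm hV hS hP F hF hne)
    refine ⟨fun e => if h : e ≤ F then (f.symm (Gold.endA (f ⟨e, h⟩))).1 else e, ?_⟩
    intro e he heF
    have hval : ∀ y : {G : Faces P // G ≤ F},
        (if h : y.1 ≤ F then (f.symm (Gold.endA (f ⟨y.1, h⟩))).1 else y.1) =
          (f.symm (Gold.endA (f y))).1 := fun y => by rw [dif_pos y.2]
    obtain ⟨h1, h2, g, hg, hg'⟩ := Gold.claimR (f ⟨e, heF⟩)
      ((edg_iso f _).2 ((edg_below _).2 he))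
    have hve := hval ⟨e, heF⟩
    simp only at hve ⊢
    rw [hve]
    refine ⟨(atm_below _).1 ((atm_iso f.symm _).2 h1), ?_, fun i => (f.symm (g i)).1,
      fun i j hij => hg (f.symm.injective (Subtype.ext hij)), fun i =>
        ⟨(edg_below _).1 ((edg_iso f.symm _).2 (hg' i).1), (f.symm (g i)).2, ?_⟩⟩
    · have h3 : f.symm (Gold.endA (f ⟨e, heF⟩)) ≤ ⟨e, heF⟩ := f.symm_apply_le.2 h2
      exact h3
    · rw [hval (f.symm (g i)), f.apply_symm_apply, (hg' i).2]
  · have hPne : P.Nonempty := hP.mono interior_subset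
    obtain ⟨s, hs, -⟩ := hV.exists_mem (G := ⟨P, IsExposed.refl _⟩) hPne
    obtain ⟨f⟩ := hver (hV.pt hs) (faceRank_pt hV hs)
    obtain ⟨x, hx⟩ := Gold.exists_atmI
    obtain ⟨g, -, hg⟩ := habove s hs (f.symm x) ((atm_iso f.symm x).2 hx)
    have hF := (hg 0).1
    have hsF : s ∈ (g 0).1 := (hV.pt_le hs _).1 ((f.symm x).2.trans (hg 0).2)
    obtain ⟨f'⟩ := hfac (g 0) (faceRank_coatm hV hS hP _ hF ⟨s, hsF⟩)
    obtain ⟨y, hy⟩ := Gold.exists_edgR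
    exact ⟨(f'.symm y).1, g 0, (edg_below _).1 ((edg_iso f'.symm y).2 hy), hF, (f'.symm y).2⟩
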